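/- arXiv:1605.04000 — 10 statements merged into one kernel-verified Lean document; each statement's English description precedes it below -/
import Mathlib

section
/- The 4×4 matrix B₀ = [[1,1,0,0],[0,1,1,0],[0,0,1,1],[1,0,0,1]] over the reals has conventional rank 3, but its nonnegative rank equals 4; that is, B₀ can be written as a sum of 4 but not of 3 nonnegative rank-one real matrices. -/
/-- `A` is a sum of `k` rank-one matrices with nonnegative entries in the subfield `F` of `ℝ`. -/
def NNDecomp (F : Subfield ℝ) {m n : Type*} (A : Matrix m n ℝ) (k : ℕ) : Prop :=
  ∃ u : Fin k → m → ℝ, ∃ v : Fin k → n → ℝ,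
    (∀ l i, 0 ≤ u l i ∧ u l i ∈ F) ∧ (∀ l j, 0 ≤ v l j ∧ v l j ∈ F) ∧
    A = ∑ l, Matrix.vecMulVec (u l) (v l)

/-- The nonnegative rank of `A` with respect to the subfield `F` of `ℝ`. -/
noncomputable def nnRank (F : Subfield ℝ) {m n : Type*} (A : Matrix m n ℝ) : ℕ :=
  sInf {k | NNDecomp F A k}

def B0 : Matrix (Fin 4) (Fin 4) ℝ :=
  !![1,1,0,0;
     0,1,1,0;
     0,0,1,1;
     1,0,0,1]

theorem B0_fool (i j : Fin 4) (h : i ≠ j) : B0 i j = 0 ∨ B0 j i = 0 := by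
  fin_cases i <;> fin_cases j <;> simp [B0] at h ⊢

theorem B0_diag (i : Fin 4) : B0 i i = 1 := by
  fin_cases i <;> simp [B0]

theorem B0_lower {k : ℕ} (h : NNDecomp ⊤ B0 k) : 4 ≤ k := by
  obtain ⟨u, v, hu, hv, hA⟩ := h
  have hent : ∀ i j, B0 i j = ∑ l, u l i * v l j := by
    intro i j
    rw [hA]
    simp [Matrix.sum_apply, Matrix.vecMulVec_apply]
  have hnn : ∀ l i j, 0 ≤ u l i * v l j := fun l i j => mul_nonneg (hu l i).1 (hv l j).1
  have hzero : ∀ i j, B0 i j = 0 → ∀ l, u l i * v l j = 0 := by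
    intro i j hij l
    rw [hent, Finset.sum_eq_zero_iff_of_nonneg (fun l _ => hnn l i j)] at hij
    exact hij l (Finset.mem_univ l)
  have hex : ∀ i, ∃ l, u l i * v l i ≠ 0 := by
    intro i
    by_contra! hc
    have h1 := hent i i
    rw [B0_diag, Finset.sum_eq_zero (fun l _ => hc l)] at h1
    exact one_ne_zero h1
  choose f hf using hex
  have hinj : Function.Injective f := by
    intro i j hij
    by_contra hne
    have h1 := hf i
    have h2 := hf j
    rw [← hij] at h2
    rcases B0_fool i j hne with h | h
    · exact mul_ne_zero (left_ne_zero_of_mul h1) (right_ne_zero_of_mul h2) (hzero _ _ h (f i))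
    · exact mul_ne_zero (left_ne_zero_of_mul h2) (right_ne_zero_of_mul h1) (hzero _ _ h (f i))
  simpa using Fintype.card_le_of_injective f hinj

theorem B0_four : NNDecomp ⊤ B0 4 := by
  refine ⟨fun l i => if i = l then 1 else 0, fun l j => B0 l j, ?_, ?_, ?_⟩
  · intro l i
    exact ⟨by dsimp only; split_ifs <;> norm_num, Subfield.mem_top _⟩
  · intro l j
    refine ⟨?_, Subfield.mem_top _⟩
    fin_cases l <;> fin_cases j <;> simp [B0]
  · ext i j
    simp [Matrix.sum_apply, Matrix.vecMulVec_apply]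

theorem B0_rank : B0.rank = 3 := by
  apply le_antisymm
  · have h : B0 = (!![1,0,0;0,1,0;0,0,1;1,-1,1] : Matrix (Fin 4) (Fin 3) ℝ) *
        (!![1,1,0,0;0,1,1,0;0,0,1,1] : Matrix (Fin 3) (Fin 4) ℝ) := by
      ext i j
      fin_cases i <;> fin_cases j <;> simp [B0, Matrix.mul_apply, Fin.sum_univ_succ]
    rw [h]
    exact (Matrix.rank_mul_le_left _ _).trans (by simpa using Matrix.rank_le_width (R := ℝ) _)
  · have h : (1 : Matrix (Fin 3) (Fin 3) ℝ) = ((!![1,-1,1,0;0,1,-1,0;0,0,1,0] : Matrix (Fin 3) (Fin 4) ℝ) *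
        B0) * (!![1,0,0;0,1,0;0,0,1;0,0,0] : Matrix (Fin 4) (Fin 3) ℝ) := by
      ext i j
      fin_cases i <;> fin_cases j <;> simp [B0, Matrix.mul_apply, Fin.sum_univ_succ]
    have h3 : (1 : Matrix (Fin 3) (Fin 3) ℝ).rank = 3 := by simp
    rw [← h3, h]
    exact (Matrix.rank_mul_le_left _ _).trans (Matrix.rank_mul_le_right _ _)

theorem stmt0 :
    B0.rank = 3 ∧ NNDecomp ⊤ B0 4 ∧ ¬ NNDecomp ⊤ B0 3 ∧ nnRank ⊤ B0 = 4 := by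
  refine ⟨B0_rank, B0_four, fun h => by have := B0_lower h; omega, ?_⟩
  exact le_antisymm (Nat.sInf_le B0_four) (le_csInf ⟨4, B0_four⟩ fun k hk => B0_lower hk)
end

section
/- Let F be a subfield of ℝ, let n ≥ 1, and let α₁,…,αₙ be nonnegative elements of F. Define the 5×(n+4) matrix B(α₁,…,αₙ) whose first row is (α₁,…,αₙ,1,1,1,1), second row is (1,…,1,1,1,0,0), third row is (0,…,0,0,1,1,0), fourth row is (0,…,0,0,0,1,1), and fifth row is (0,…,0,1,0,0,1). Then the nonnegative rank of B(α₁,…,αₙ) with respect to F equals 4 if and only if α₁ = … = αₙ and this common value lies in [0,1] ∩ F. -/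
/-- The 5 × (n+4) matrix 𝓑(α₁,…,αₙ) of the paper. -/
def Bmat {n : ℕ} (α : Fin n → ℝ) : Matrix (Fin 5) (Fin (n + 4)) ℝ :=
  Matrix.of
    ![Fin.append α ![1,1,1,1],
      Fin.append (fun _ => 1) ![1,1,0,0],
      Fin.append (fun _ => 0) ![0,1,1,0],
      Fin.append (fun _ => 0) ![0,0,1,1],
      Fin.append (fun _ => 0) ![1,0,0,1]]

theorem entry_sum (F : Subfield ℝ) {n k : ℕ} (α : Fin n → ℝ) (u : Fin k → Fin 5 → ℝ)
    (v : Fin k → Fin (n + 4) → ℝ) (h : Bmat α = ∑ l, Matrix.vecMulVec (u l) (v l)) (i j) :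
    ∑ l, u l i * v l j = Bmat α i j := by
  rw [h, Matrix.sum_apply]
  rfl

theorem entry_zero {k : ℕ} {f g : Fin k → ℝ} (hf : ∀ l, 0 ≤ f l) (hg : ∀ l, 0 ≤ g l)
    (h : ∑ l, f l * g l = 0) (l : Fin k) : f l = 0 ∨ g l = 0 := by
  rw [Finset.sum_eq_zero_iff_of_nonneg (fun l _ => mul_nonneg (hf l) (hg l))] at h
  exact mul_eq_zero.mp (h l (Finset.mem_univ l))

theorem entry_one {k : ℕ} {f g : Fin k → ℝ} (h : ∑ l, f l * g l = 1) :
    ∃ l, f l ≠ 0 ∧ g l ≠ 0 := by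
  by_contra! hc
  rw [Finset.sum_eq_zero] at h
  · exact zero_ne_one h
  · intro l _
    by_cases hl : f l = 0
    · simp [hl]
    · simp [hc l hl]

/-- Entrywise form of a decomposition. -/
structure Ent {n k : ℕ} (α : Fin n → ℝ) (u : Fin k → Fin 5 → ℝ)
    (w : Fin k → Fin n → ℝ) (v : Fin k → Fin 4 → ℝ) : Prop where
  hu : ∀ l i, 0 ≤ u l i
  hw : ∀ l i, 0 ≤ w l i
  hv : ∀ l i, 0 ≤ v l i
  hα : ∀ j, ∑ l, u l 0 * w l j = α j
  h1 : ∀ j, ∑ l, u l 1 * w l j = 1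
  w2 : ∀ j l, u l 2 = 0 ∨ w l j = 0
  w3 : ∀ j l, u l 3 = 0 ∨ w l j = 0
  w4 : ∀ j l, u l 4 = 0 ∨ w l j = 0
  t0 : ∑ l, u l 0 * v l 0 = 1
  o10 : ∑ l, u l 1 * v l 0 = 1
  o11 : ∑ l, u l 1 * v l 1 = 1
  o21 : ∑ l, u l 2 * v l 1 = 1
  o22 : ∑ l, u l 2 * v l 2 = 1
  o32 : ∑ l, u l 3 * v l 2 = 1
  o33 : ∑ l, u l 3 * v l 3 = 1
  o43 : ∑ l, u l 4 * v l 3 = 1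
  o40 : ∑ l, u l 4 * v l 0 = 1
  z12 : ∀ l, u l 1 = 0 ∨ v l 2 = 0
  z13 : ∀ l, u l 1 = 0 ∨ v l 3 = 0
  z20 : ∀ l, u l 2 = 0 ∨ v l 0 = 0
  z23 : ∀ l, u l 2 = 0 ∨ v l 3 = 0
  z30 : ∀ l, u l 3 = 0 ∨ v l 0 = 0
  z31 : ∀ l, u l 3 = 0 ∨ v l 1 = 0
  z41 : ∀ l, u l 4 = 0 ∨ v l 1 = 0
  z42 : ∀ l, u l 4 = 0 ∨ v l 2 = 0

theorem NNDecomp.ent {F : Subfield ℝ} {n k : ℕ} {α : Fin n → ℝ} (h : NNDecomp F (Bmat α) k) :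
    ∃ u w v, Ent (k := k) α u w v := by
  obtain ⟨u, v, hu, hv, h⟩ := h
  have hs := entry_sum F α u v h
  have hu' := fun l i => (hu l i).1
  have hv' := fun l i => (hv l i).1
  refine ⟨u, fun l j => v l (Fin.castAdd 4 j), fun l c => v l (Fin.natAdd n c), ?_⟩
  constructor
  case hu => exact hu'
  case hw => exact fun _ _ => hv' _ _
  case hv => exact fun _ _ => hv' _ _
  case w2 | w3 | w4 =>
    intro j
    exact entry_zero (fun l => hu' l _) (fun l => hv' l _) (by rw [hs]; simp [Bmat])
  case z12 | z13 | z20 | z23 | z30 | z31 | z41 | z42 =>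
    exact entry_zero (fun l => hu' l _) (fun l => hv' l _) (by rw [hs]; simp [Bmat])
  all_goals
    intros
    rw [hs]; simp [Bmat]

theorem Ent.fool {n k : ℕ} {α : Fin n → ℝ} {u w v} (h : Ent (k := k) α u w v) (j : Fin n) :
    ∃ d a b c : Fin k, u d 1 ≠ 0 ∧ w d j ≠ 0 ∧ u a 2 ≠ 0 ∧ v a 1 ≠ 0 ∧ u b 3 ≠ 0 ∧ v b 2 ≠ 0 ∧
      u c 4 ≠ 0 ∧ v c 3 ≠ 0 ∧ d ≠ a ∧ d ≠ b ∧ d ≠ c ∧ a ≠ b ∧ a ≠ c ∧ b ≠ c := by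
  obtain ⟨d, hd, hd'⟩ := entry_one (h.h1 j)
  obtain ⟨a, ha, ha'⟩ := entry_one h.o21
  obtain ⟨b, hb, hb'⟩ := entry_one h.o32
  obtain ⟨c, hc, hc'⟩ := entry_one h.o43
  refine ⟨d, a, b, c, hd, hd', ha, ha', hb, hb', hc, hc', ?_, ?_, ?_, ?_, ?_, ?_⟩ <;> rintro rfl
  · have := h.w2 j d; tauto
  · have := h.w3 j d; tauto
  · have := h.w4 j d; tauto
  · have := h.z31 a; tauto
  · have := h.z41 a; tauto
  · have := h.z42 b; tauto

theorem Ent.four_le {n k : ℕ} {α : Fin n → ℝ} {u w v} (h : Ent (k := k) α u w v) (j : Fin n) :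
    4 ≤ k := by
  obtain ⟨d, a, b, c, -, -, -, -, -, -, -, -, h1, h2, h3, h4, h5, h6⟩ := h.fool j
  omega

theorem fin4 (d a b c l : Fin 4) (h1 : d ≠ a) (h2 : d ≠ b) (h3 : d ≠ c) (h4 : a ≠ b) (h5 : a ≠ c)
    (h6 : b ≠ c) (hl : l ≠ d) : l = a ∨ l = b ∨ l = c := by omega

theorem Ent.main {n : ℕ} {α : Fin n → ℝ} {u w v} (h : Ent (k := 4) α u w v) (j0 : Fin n) :
    ∃ t : ℝ, (∀ i, α i = t) ∧ t ≤ 1 := by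
  obtain ⟨d, a, b, c, hd, hd', ha, ha', hb, hb', hc, hc', h1, h2, h3, h4, h5, h6⟩ := h.fool j0
  have hl := fun l => fin4 d a b c l h1 h2 h3 h4 h5 h6
  -- every term other than `d` vanishes on the first `n` columns
  have hw : ∀ j l, l ≠ d → w l j = 0 := by
    intro j l hld
    rcases hl l hld with rfl | rfl | rfl
    · have := h.w2 j l; tauto
    · have := h.w3 j l; tauto
    · have := h.w4 j l; tauto
  -- and the entry (1, c0) is covered by `d` only
  have h10 : ∀ l, l ≠ d → u l 1 * v l 0 = 0 := by
    intro l hld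
    rw [mul_eq_zero]
    rcases hl l hld with rfl | rfl | rfl
    · have := h.z20 l; tauto
    · have := h.z30 l; tauto
    · have := h.z13 l; tauto
  have e1 : ∀ j, u d 1 * w d j = 1 := by
    intro j
    rw [← h.h1 j, Finset.sum_eq_single d]
    · intro l _ hld; rw [hw j l hld, mul_zero]
    · simp
  have e0 : ∀ j, u d 0 * w d j = α j := by
    intro j
    rw [← h.hα j, Finset.sum_eq_single d]
    · intro l _ hld; rw [hw j l hld, mul_zero]
    · simp
  have ev : u d 1 * v d 0 = 1 := by
    rw [← h.o10, Finset.sum_eq_single d]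
    · intro l _ hld; exact h10 l hld
    · simp
  have hle : u d 0 * v d 0 ≤ 1 := by
    rw [← h.t0]
    exact Finset.single_le_sum (f := fun l => u l 0 * v l 0)
      (fun l _ => mul_nonneg (h.hu _ _) (h.hv _ _)) (Finset.mem_univ d)
  have hv0 : ∀ j, w d j = v d 0 := fun j => mul_left_cancel₀ hd ((e1 j).trans ev.symm)
  exact ⟨u d 0 * v d 0, fun i => by rw [← e0, hv0], hle⟩

theorem decomp_four (F : Subfield ℝ) {n : ℕ} (α : Fin n → ℝ) (t : ℝ) (h : ∀ i, α i = t)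
    (h0 : 0 ≤ t) (h1 : t ≤ 1) (hF : t ∈ F) : NNDecomp F (Bmat α) 4 := by
  refine ⟨![![t,1,0,0,0], ![1-t,0,1,0,0], ![t,0,0,1,0], ![1-t,0,0,0,1]],
    ![Fin.append (fun _ => 1) ![1,1,0,0], Fin.append (fun _ => 0) ![0,1,1,0],
      Fin.append (fun _ => 0) ![0,0,1,1], Fin.append (fun _ => 0) ![1,0,0,1]], ?_, ?_, ?_⟩
  · have h2 := F.sub_mem F.one_mem hF
    have h3 := F.one_mem
    have h4 := F.zero_mem
    intro l i
    fin_cases l <;> fin_cases i <;> simp [h0, h1, hF, h2, h3, h4]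
  · have h3 := F.one_mem
    have h4 := F.zero_mem
    intro l j
    refine Fin.addCases (fun j => ?_) (fun c => ?_) j
    · fin_cases l <;> simp [h3, h4]
    · fin_cases l <;> fin_cases c <;> simp [h3, h4]
  · ext i j
    rw [Matrix.sum_apply, Fin.sum_univ_four]
    refine Fin.addCases (fun j => ?_) (fun c => ?_) j
    · fin_cases i <;> simp [Bmat, Matrix.vecMulVec_apply, h]
    · fin_cases i <;> fin_cases c <;> simp [Bmat, Matrix.vecMulVec_apply]

theorem stmt1 (F : Subfield ℝ) (n : ℕ) (hn : 1 ≤ n) (α : Fin n → ℝ)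
    (hα : ∀ i, 0 ≤ α i ∧ α i ∈ F) :
    nnRank F (Bmat α) = 4 ↔
      ∃ t : ℝ, (∀ i, α i = t) ∧ t ∈ Set.Icc (0 : ℝ) 1 ∧ t ∈ F := by
  have j0 : Fin n := ⟨0, hn⟩
  constructor
  · intro hr
    have hne : {k | NNDecomp F (Bmat α) k}.Nonempty := by
      by_contra hc
      rw [Set.not_nonempty_iff_eq_empty] at hc
      simp [nnRank, hc] at hr
    have hm : NNDecomp F (Bmat α) (nnRank F (Bmat α)) := Nat.sInf_mem hne
    rw [hr] at hm
    obtain ⟨u, w, v, he⟩ := hm.ent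
    obtain ⟨t, ht, ht1⟩ := he.main j0
    refine ⟨t, ht, ⟨?_, ht1⟩, ?_⟩
    · rw [← ht j0]; exact (hα j0).1
    · rw [← ht j0]; exact (hα j0).2
  · rintro ⟨t, ht, ⟨h0, h1⟩, hF⟩
    have h4 := decomp_four F α t ht h0 h1 hF
    refine le_antisymm (Nat.sInf_le h4) (le_csInf ⟨4, h4⟩ ?_)
    intro k hk
    obtain ⟨u, w, v, he⟩ := NNDecomp.ent hk
    exact he.four_le j0
end

section
/- Let F be a subfield of ℝ, let A ∈ F^{m×n}, B ∈ F^{m×k}, c ∈ F^{1×n} be nonnegative matrices, and let r, s be positive integers. For x ∈ F, let 𝒜(x) denote the (m+1)×(n+k) block matrix with top-left block A, top-right block B, bottom-left block c, and bottom-right block the 1×k row (x,…,x). Let 𝒢 be the (m+5)×(n+k+4) block matrix whose top-left (m+1)×(n+k) block is 𝒜(s), whose rows m+2,…,m+5 restricted to the first n columns are zero, whose rows m+2,…,m+5 restricted to the next k columns are (1,…,1), (0,…,0), (0,…,0), (0,…,0) respectively, whose row m+1 restricted to the last 4 columns is (1,1,1,1), whose rows 1,…,m restricted to the last 4 columns are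 zero, and whose bottom-right 4×4 block is [[1,1,0,0],[0,1,1,0],[0,0,1,1],[1,0,0,1]]. Assume that either rank_{F+} A ≥ r or k = 1. Then rank_{F+} 𝒢 ≤ r + 4 if and only if there exists ξ ∈ [s−1, s] ∩ F such that rank_{F+} 𝒜(ξ) ≤ r. -/
/-- The (m+1) × (n+k) block matrix 𝒜(x) with blocks A, B, c and bottom-right row (x,…,x). -/
def Amat {m n k : ℕ} (A : Matrix (Fin m) (Fin n) ℝ) (B : Matrix (Fin m) (Fin k) ℝ)
    (c : Fin n → ℝ) (x : ℝ) : Matrix (Fin m ⊕ Fin 1) (Fin n ⊕ Fin k) ℝ :=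
  Matrix.fromBlocks A B (Matrix.of fun _ j => c j) (Matrix.of fun _ _ => x)

/-- The (m+5) × (n+k+4) matrix 𝒢 of Theorem pr3. -/
def Gmat {m n k : ℕ} (A : Matrix (Fin m) (Fin n) ℝ) (B : Matrix (Fin m) (Fin k) ℝ)
    (c : Fin n → ℝ) (s : ℝ) :
    Matrix ((Fin m ⊕ Fin 1) ⊕ Fin 4) ((Fin n ⊕ Fin k) ⊕ Fin 4) ℝ :=
  Matrix.fromBlocks (Amat A B c s)
    (Matrix.of fun i _ => Sum.elim (fun _ => (0 : ℝ)) (fun _ => 1) i)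
    (Matrix.of fun i j => Sum.elim (fun _ => (0 : ℝ)) (fun _ => if i = 0 then 1 else 0) j)
    B0

lemma nnRank_le_finset (F : Subfield ℝ) {m n ι : Type*} (M : Matrix m n ℝ) (T : Finset ι)
    (u : ι → m → ℝ) (v : ι → n → ℝ)
    (hu : ∀ l i, 0 ≤ u l i ∧ u l i ∈ F) (hv : ∀ l j, 0 ≤ v l j ∧ v l j ∈ F)
    (h : ∀ i j, M i j = ∑ l ∈ T, u l i * v l j) : nnRank F M ≤ T.card := by
  apply Nat.sInf_le
  refine ⟨fun l => u (T.equivFin.symm l), fun l => v (T.equivFin.symm l),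
    fun l i => hu _ i, fun l j => hv _ j, ?_⟩
  ext i j
  rw [h, Matrix.sum_apply]
  simp only [Matrix.vecMulVec_apply]
  rw [Equiv.sum_comp T.equivFin.symm (fun x : T => u x i * v x j)]
  exact (Finset.sum_coe_sort T (fun l => u l i * v l j)).symm

lemma exists_decomp (F : Subfield ℝ) {m n : Type*} [Fintype m] [Fintype n] [DecidableEq m]
    (M : Matrix m n ℝ) (hM : ∀ i j, 0 ≤ M i j ∧ M i j ∈ F) (r : ℕ) (hr : nnRank F M ≤ r) :
    ∃ u : Fin r → m → ℝ, ∃ v : Fin r → n → ℝ,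
    (∀ l i, 0 ≤ u l i ∧ u l i ∈ F) ∧ (∀ l j, 0 ≤ v l j ∧ v l j ∈ F) ∧
    ∀ i j, M i j = ∑ l, u l i * v l j := by
  have hne : {k | NNDecomp F M k}.Nonempty := by
    let e := Fintype.equivFin m
    refine ⟨Fintype.card m, fun l i => if e i = l then 1 else 0, fun l j => M (e.symm l) j,
      ?_, fun l j => hM _ _, ?_⟩
    · intro l i
      dsimp only
      split_ifs
      · exact ⟨zero_le_one, one_mem F⟩
      · exact ⟨le_refl _, zero_mem F⟩
    · ext i j
      rw [Matrix.sum_apply]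
      simp [Matrix.vecMulVec_apply]
  obtain ⟨u, v, hu, hv, h⟩ : NNDecomp F M (nnRank F M) := Nat.sInf_mem hne
  generalize nnRank F M = p at *
  obtain ⟨q, rfl⟩ := Nat.exists_eq_add_of_le hr
  refine ⟨Fin.append u (fun _ _ => 0), Fin.append v (fun _ _ => 0), ?_, ?_, ?_⟩
  · intro l i
    refine Fin.addCases (fun l => ?_) (fun l => ?_) l
    · simpa using hu l i
    · simp
  · intro l i
    refine Fin.addCases (fun l => ?_) (fun l => ?_) l
    · simpa using hv l i
    · simp
  · intro i j
    rw [h, Matrix.sum_apply, Fin.sum_univ_add]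
    simp [Matrix.vecMulVec_apply]

lemma nonneg_zero_of_sum {ι : Type*} (T : Finset ι) (f : ι → ℝ) (hf : ∀ l, 0 ≤ f l)
    {x : ℝ} (h : x = ∑ l ∈ T, f l) (l : ι) (hl : l ∈ T) : f l ≤ x := by
  rw [h]
  exact Finset.single_le_sum (fun i _ => hf i) hl

/-- The combinatorial core: factorizations of `B0` of size four. -/
lemma core (U V : Fin 4 → Fin 4 → ℝ) (hU : ∀ l i, 0 ≤ U l i) (hV : ∀ l i, 0 ≤ V l i)
    (hB : ∀ i j, B0 i j = ∑ l, U l i * V l j) (hd : ∀ l, 0 < U l l * V l l) :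
    (∀ l i, i ≠ l → U l i = 0) ∨ (∀ l, 0 < U l (l - 1)) := by
  have hUp : ∀ l, 0 < U l l := fun l => (hU l l).lt_of_ne
    (fun h => by have := hd l; rw [← h] at this; simp at this)
  have hVp : ∀ l, 0 < V l l := fun l => (hV l l).lt_of_ne
    (fun h => by have := hd l; rw [← h] at this; simp at this)
  have hz : ∀ i j, B0 i j = 0 → ∀ l, U l i * V l j = 0 := by
    intro i j h0 l
    apply le_antisymm _ (mul_nonneg (hU _ _) (hV _ _))
    rw [← h0]
    exact nonneg_zero_of_sum Finset.univ (fun l => U l i * V l j)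
      (fun l => mul_nonneg (hU _ _) (hV _ _)) (hB i j) l (Finset.mem_univ _)
  have hUz : ∀ l i, B0 i l = 0 → U l i = 0 := fun l i h =>
    (mul_eq_zero.1 (hz i l h l)).resolve_right (hVp l).ne'
  have hVz : ∀ l j, B0 l j = 0 → V l j = 0 := fun l j h =>
    (mul_eq_zero.1 (hz l j h l)).resolve_left (hUp l).ne'
  have u01 := hUz 0 1 (by simp [B0])
  have u02 := hUz 0 2 (by simp [B0])
  have u12 := hUz 1 2 (by simp [B0])
  have u13 := hUz 1 3 (by simp [B0])
  have u20 := hUz 2 0 (by simp [B0])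
  have u23 := hUz 2 3 (by simp [B0])
  have u30 := hUz 3 0 (by simp [B0])
  have u31 := hUz 3 1 (by simp [B0])
  have v02 := hVz 0 2 (by simp [B0])
  have v03 := hVz 0 3 (by simp [B0])
  have v10 := hVz 1 0 (by simp [B0])
  have v13 := hVz 1 3 (by simp [B0])
  have v20 := hVz 2 0 (by simp [B0])
  have v21 := hVz 2 1 (by simp [B0])
  have v31 := hVz 3 1 (by simp [B0])
  have v32 := hVz 3 2 (by simp [B0])
  have e01 := hB 0 1
  have e12 := hB 1 2
  have e23 := hB 2 3
  have e30 := hB 3 0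
  simp [B0, Fin.sum_univ_four, *] at e01 e12 e23 e30
  -- exclusivity
  have x0 := hz 3 1 (by simp [B0]) 0
  have x1 := hz 0 2 (by simp [B0]) 1
  have x2 := hz 1 3 (by simp [B0]) 2
  have x3 := hz 2 0 (by simp [B0]) 3
  rw [mul_eq_zero] at x0 x1 x2 x3
  have key : (U 0 3 = 0 ∧ U 1 0 = 0 ∧ U 2 1 = 0 ∧ U 3 2 = 0) ∨
      (U 0 3 ≠ 0 ∧ U 1 0 ≠ 0 ∧ U 2 1 ≠ 0 ∧ U 3 2 ≠ 0) := by
    have y0 : U 0 3 = 0 → U 3 2 = 0 := by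
      intro h; rcases x3 with x | x
      · exact x
      · simp [h, x] at e30
    have y3 : U 3 2 = 0 → U 2 1 = 0 := by
      intro h; rcases x2 with x | x
      · exact x
      · simp [h, x] at e23
    have y2 : U 2 1 = 0 → U 1 0 = 0 := by
      intro h; rcases x1 with x | x
      · exact x
      · simp [h, x] at e12
    have y1 : U 1 0 = 0 → U 0 3 = 0 := by
      intro h; rcases x0 with x | x
      · exact x
      · simp [h, x] at e01
    tauto
  rcases key with ⟨a, b, c, d⟩ | ⟨a, b, c, d⟩
  · left
    intro l i hli
    fin_cases l <;> fin_cases i <;> first | exact absurd rfl hli | assumption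
  · right
    intro l
    apply (hU _ _).lt_of_ne'
    fin_cases l <;> assumption

lemma core2 {k : ℕ} (U V : Fin 4 → Fin 4 → ℝ) (hU : ∀ l i, 0 ≤ U l i) (hV : ∀ l i, 0 ≤ V l i)
    (hB : ∀ i j, B0 i j = ∑ l, U l i * V l j) (hd : ∀ l, 0 < U l l * V l l)
    (a : Fin 4 → ℝ) (d : Fin 4 → Fin k → ℝ) (ha : ∀ l, 0 ≤ a l) (hd0 : ∀ l q, 0 ≤ d l q)
    (h1 : ∀ l i q, U l i * d l q ≤ if i = 0 then 1 else 0)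
    (h2 : ∀ l j, a l * V l j ≤ 1) :
    (∀ q, ∑ l, a l * d l q ≤ 1) ∧
    ((∀ i q, (if i = 0 then 1 else 0) = ∑ l, U l i * d l q) →
      ∀ q q', ∑ l, a l * d l q = ∑ l, a l * d l q') := by
  have hdz : ∀ l i q, i ≠ 0 → 0 < U l i → d l q = 0 := by
    intro l i q hi hp
    have := h1 l i q
    rw [if_neg hi] at this
    have h3 := hd0 l q
    by_contra hne
    have := mul_pos hp (h3.lt_of_ne' hne)
    linarith
  have hUp : ∀ l, 0 < U l l := fun l => (hU l l).lt_of_ne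
    (fun h => by have := hd l; rw [← h] at this; simp at this)
  have z1 : ∀ q, d 1 q = 0 := fun q => hdz 1 1 q (by decide) (hUp 1)
  have z2 : ∀ q, d 2 q = 0 := fun q => hdz 2 2 q (by decide) (hUp 2)
  have z3 : ∀ q, d 3 q = 0 := fun q => hdz 3 3 q (by decide) (hUp 3)
  simp only [Fin.sum_univ_four, z1, z2, z3, mul_zero, add_zero]
  rcases core U V hU hV hB hd with h | h
  · have e := hB 0 0
    simp [B0, Fin.sum_univ_four, h 1 0 (by decide), h 2 0 (by decide), h 3 0 (by decide)] at e
    constructor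
    · intro q
      have p1 := h1 0 0 q
      have p2 := h2 0 0
      simp at p1
      have p3 : 0 ≤ U 0 0 * d 0 q := mul_nonneg (hU _ _) (hd0 _ _)
      calc a 0 * d 0 q = (a 0 * V 0 0) * (U 0 0 * d 0 q) := by
            linear_combination (a 0 * d 0 q) * e
        _ ≤ 1 * 1 := mul_le_mul p2 p1 p3 zero_le_one
        _ = 1 := one_mul 1
    · intro hh q q'
      have p := hh 0 q
      have p' := hh 0 q'
      simp at p p'
      have : d 0 q = d 0 q' := mul_left_cancel₀ (hUp 0).ne' (p.symm.trans p')
      rw [this]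
  · have z0 : ∀ q, d 0 q = 0 := fun q => hdz 0 (0 - 1) q (by decide) (h 0)
    simp [z0]

theorem stmt2 (F : Subfield ℝ) (m n k : ℕ)
    (A : Matrix (Fin m) (Fin n) ℝ) (B : Matrix (Fin m) (Fin k) ℝ) (c : Fin n → ℝ)
    (hA : ∀ i j, 0 ≤ A i j ∧ A i j ∈ F) (hB : ∀ i j, 0 ≤ B i j ∧ B i j ∈ F)
    (hc : ∀ j, 0 ≤ c j ∧ c j ∈ F)
    (r s : ℕ) (hr : 0 < r) (hs : 0 < s)
    (hyp : r ≤ nnRank F A ∨ k = 1) :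
    nnRank F (Gmat A B c (s : ℝ)) ≤ r + 4 ↔
      ∃ ξ : ℝ, ξ ∈ F ∧ ξ ∈ Set.Icc ((s : ℝ) - 1) (s : ℝ) ∧
        nnRank F (Amat A B c ξ) ≤ r := by
  have hsF : (s : ℝ) ∈ F := natCast_mem F s
  have hs1 : (1 : ℝ) ≤ s := by exact_mod_cast hs
  have hAm : ∀ x : ℝ, 0 ≤ x → x ∈ F → ∀ i j, 0 ≤ Amat A B c x i j ∧ Amat A B c x i j ∈ F := by
    intro x hx hxF i j
    rcases i with i | i <;> rcases j with j | j <;> simp [Amat]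
    · exact hA i j
    · exact hB i j
    · exact hc j
    · exact ⟨hx, hxF⟩
  have hG : ∀ i j, 0 ≤ Gmat A B c s i j ∧ Gmat A B c s i j ∈ F := by
    intro i j
    rcases i with i | i <;> rcases j with j | j
    · exact hAm s (by linarith) hsF i j
    · rcases i with i | i <;> simp [Gmat, one_mem, zero_mem]
    · rcases j with j | j <;> simp only [Gmat, Matrix.fromBlocks_apply₂₁, Matrix.of_apply,
        Sum.elim_inl, Sum.elim_inr]
      · exact ⟨le_refl _, zero_mem F⟩
      · split_ifs
        · exact ⟨zero_le_one, one_mem F⟩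
        · exact ⟨le_refl _, zero_mem F⟩
    · fin_cases i <;> fin_cases j <;> simp [Gmat, B0, one_mem, zero_mem]
  constructor
  · intro hrk
    obtain ⟨u, v, hu, hv, h⟩ := exists_decomp F _ hG _ hrk
    -- block equations
    have hAA : ∀ i j, A i j = ∑ l, u l (.inl (.inl i)) * v l (.inl (.inl j)) :=
      fun i j => h (.inl (.inl i)) (.inl (.inl j))
    have hBB : ∀ i j, B i j = ∑ l, u l (.inl (.inl i)) * v l (.inl (.inr j)) :=
      fun i j => h (.inl (.inl i)) (.inl (.inr j))
    have hcc : ∀ j, c j = ∑ l, u l (.inl (.inr 0)) * v l (.inl (.inl j)) :=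
      fun j => h (.inl (.inr 0)) (.inl (.inl j))
    have hss : ∀ q : Fin k, (s : ℝ) = ∑ l, u l (.inl (.inr 0)) * v l (.inl (.inr q)) :=
      fun q => h (.inl (.inr 0)) (.inl (.inr q))
    have h0r : ∀ i j, (0 : ℝ) = ∑ l, u l (.inl (.inl i)) * v l (.inr j) :=
      fun i j => h (.inl (.inl i)) (.inr j)
    have h1r : ∀ j, (1 : ℝ) = ∑ l, u l (.inl (.inr 0)) * v l (.inr j) :=
      fun j => h (.inl (.inr 0)) (.inr j)
    have h0d : ∀ i j, (0 : ℝ) = ∑ l, u l (.inr i) * v l (.inl (.inl j)) :=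
      fun i j => h (.inr i) (.inl (.inl j))
    have h1d : ∀ i q, (if i = 0 then 1 else 0 : ℝ) = ∑ l, u l (.inr i) * v l (.inl (.inr q)) :=
      fun i q => h (.inr i) (.inl (.inr q))
    have hB0 : ∀ i j, B0 i j = ∑ l, u l (.inr i) * v l (.inr j) :=
      fun i j => h (.inr i) (.inr j)
    clear h
    have hnn : ∀ l i j, 0 ≤ u l i * v l j := fun l i j => mul_nonneg (hu l i).1 (hv l j).1
    have hle : ∀ {x : ℝ} {i j}, x = ∑ l, u l i * v l j → ∀ l, u l i * v l j ≤ x := by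
      intro x i j h l
      exact nonneg_zero_of_sum Finset.univ (fun l => u l i * v l j) (fun l => hnn l i j) h l
        (Finset.mem_univ _)
    have hz : ∀ {i j}, 0 = ∑ l, u l i * v l j → ∀ l, u l i * v l j = 0 :=
      fun h l => le_antisymm (hle h l) (hnn _ _ _)
    -- bottom rows nonzero kill the first columns; last columns nonzero kill the top rows
    have killV : ∀ l i, u l (.inr i) ≠ 0 → ∀ j, v l (.inl (.inl j)) = 0 :=
      fun l i hne j => (mul_eq_zero.1 (hz (h0d i j) l)).resolve_left hne
    have killU : ∀ l j, v l (.inr j) ≠ 0 → ∀ i, u l (.inl (.inl i)) = 0 :=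
      fun l j hne i => (mul_eq_zero.1 (hz (h0r i j) l)).resolve_right hne
    -- rank bound for A
    have rankA : ∀ T : Finset (Fin (r + 4)),
        (∀ l, l ∉ T → ∀ i j, u l (.inl (.inl i)) * v l (.inl (.inl j)) = 0) →
        nnRank F A ≤ T.card := by
      intro T hT
      refine nnRank_le_finset F A T (fun l i => u l (.inl (.inl i)))
        (fun l j => v l (.inl (.inl j))) (fun l i => hu _ _) (fun l j => hv _ _) ?_
      intro i j
      rw [hAA]
      exact (Finset.sum_subset (Finset.subset_univ T) (fun l _ hl => hT l hl i j)).symm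
    classical
    let S : Finset (Fin (r + 4)) :=
      Finset.univ.filter (fun l => ∃ i j, u l (.inr i) * v l (.inr j) ≠ 0)
    have hS : ∀ l, l ∈ S ↔ ∃ i j, u l (.inr i) * v l (.inr j) ≠ 0 := by
      intro l; simp [S]
    have hSU : ∀ l ∈ S, ∀ i, u l (.inl (.inl i)) = 0 := by
      intro l hl
      obtain ⟨i, j, hij⟩ := (hS l).1 hl
      exact killU l j (right_ne_zero_of_mul hij)
    have hSV : ∀ l ∈ S, ∀ i, v l (.inl (.inl i)) = 0 := by
      intro l hl
      obtain ⟨i, j, hij⟩ := (hS l).1 hl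
      exact killV l i (left_ne_zero_of_mul hij)
    have hex : ∀ i : Fin 4, ∃ l, 0 < u l (.inr i) * v l (.inr i) := by
      intro i
      by_contra! hcon
      have h1 := hB0 i i
      rw [Finset.sum_eq_zero (fun l _ => le_antisymm (hcon l) (hnn _ _ _))] at h1
      revert h1
      fin_cases i <;> simp [B0]
    choose f hf using hex
    have hfS : ∀ i, f i ∈ S := fun i => (hS _).2 ⟨i, i, (hf i).ne'⟩
    have hinj : Function.Injective f := by
      intro i j hij
      have a1 := hf i
      have a2 := hf j
      rw [← hij] at a2
      have b1 : 0 < B0 i j := by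
        refine lt_of_lt_of_le (mul_pos ?_ ?_) (hle (hB0 i j) (f i))
        · exact (hu _ _).1.lt_of_ne' (left_ne_zero_of_mul a1.ne')
        · exact (hv _ _).1.lt_of_ne' (right_ne_zero_of_mul a2.ne')
      have b2 : 0 < B0 j i := by
        refine lt_of_lt_of_le (mul_pos ?_ ?_) (hle (hB0 j i) (f i))
        · exact (hu _ _).1.lt_of_ne' (left_ne_zero_of_mul a2.ne')
        · exact (hv _ _).1.lt_of_ne' (right_ne_zero_of_mul a1.ne')
      revert b1 b2
      fin_cases i <;> fin_cases j <;> simp [B0]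
    have himg : (Finset.univ.image f).card = 4 := by
      rw [Finset.card_image_of_injective _ hinj]; simp
    have hsub : Finset.univ.image f ⊆ S := by
      intro l hl
      obtain ⟨i, _, rfl⟩ := Finset.mem_image.1 hl
      exact hfS i
    have hcard4 : 4 ≤ S.card := himg.symm.le.trans (Finset.card_le_card hsub)
    have hcompl : Sᶜ.card + S.card = r + 4 := by
      have := Finset.card_compl_add_card S
      simpa using this
    have hrA : nnRank F A ≤ Sᶜ.card := by
      apply rankA
      intro l hl i j
      rw [hSU l (by simpa using hl), zero_mul]
    -- sums over the complement
    have cA : ∀ i j, A i j = ∑ l ∈ Sᶜ, u l (.inl (.inl i)) * v l (.inl (.inl j)) := by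
      intro i j
      rw [hAA]
      refine (Finset.sum_subset (Finset.subset_univ _) (fun l _ hl => ?_)).symm
      rw [hSU l (by simpa using hl), zero_mul]
    have cB : ∀ i j, B i j = ∑ l ∈ Sᶜ, u l (.inl (.inl i)) * v l (.inl (.inr j)) := by
      intro i j
      rw [hBB]
      refine (Finset.sum_subset (Finset.subset_univ _) (fun l _ hl => ?_)).symm
      rw [hSU l (by simpa using hl), zero_mul]
    have cc : ∀ j, c j = ∑ l ∈ Sᶜ, u l (.inl (.inr 0)) * v l (.inl (.inl j)) := by
      intro j
      rw [hcc]
      refine (Finset.sum_subset (Finset.subset_univ _) (fun l _ hl => ?_)).symm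
      rw [hSV l (by simpa using hl), mul_zero]
    have cs : ∀ q : Fin k, (s : ℝ) = ∑ l ∈ Sᶜ, u l (.inl (.inr 0)) * v l (.inl (.inr q))
        + ∑ l ∈ S, u l (.inl (.inr 0)) * v l (.inl (.inr q)) := by
      intro q
      rw [Finset.sum_compl_add_sum]
      exact hss q
    have hwF : ∀ q : Fin k, ∑ l ∈ S, u l (.inl (.inr 0)) * v l (.inl (.inr q)) ∈ F :=
      fun q => sum_mem (fun l _ => mul_mem (hu _ _).2 (hv _ _).2)
    have hw0 : ∀ q : Fin k, 0 ≤ ∑ l ∈ S, u l (.inl (.inr 0)) * v l (.inl (.inr q)) :=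
      fun q => Finset.sum_nonneg (fun l _ => hnn _ _ _)
    have fin : ∀ ξ : ℝ, (∀ q : Fin k, ξ = ∑ l ∈ Sᶜ, u l (.inl (.inr 0)) * v l (.inl (.inr q))) →
        nnRank F (Amat A B c ξ) ≤ Sᶜ.card := by
      intro ξ hξ
      refine nnRank_le_finset F _ Sᶜ (fun l i => u l (.inl i)) (fun l j => v l (.inl j))
        (fun l i => hu _ _) (fun l j => hv _ _) ?_
      intro i j
      rcases i with i | i <;> rcases j with j | j
      · exact cA i j
      · exact cB i j
      · rw [Subsingleton.elim i 0]; exact cc j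
      · rw [Subsingleton.elim i 0]; exact hξ j
    rcases hcard4.lt_or_eq with hlt | heq
    · rcases hyp with hyp | hk
      · omega
      · subst hk
        refine ⟨s, hsF, ⟨by linarith, le_refl _⟩, ?_⟩
        have : nnRank F (Amat A B c s) ≤ (Finset.insertNone Sᶜ).card := by
          refine nnRank_le_finset F _ (Finset.insertNone Sᶜ)
            (fun l => l.elim (Sum.elim (fun _ => 0) (fun _ => 1)) (fun l i => u l (.inl i)))
            (fun l => l.elim (Sum.elim (fun _ => 0)
              (fun q => ∑ l ∈ S, u l (.inl (.inr 0)) * v l (.inl (.inr q))))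
              (fun l j => v l (.inl j))) ?_ ?_ ?_
          · rintro (_ | l) i
            · rcases i with i | i <;> simp [one_mem, zero_mem]
            · exact hu _ _
          · rintro (_ | l) j
            · rcases j with j | j
              · simp [zero_mem]
              · exact ⟨hw0 j, hwF j⟩
            · exact hv _ _
          · intro i j
            rw [Finset.sum_insertNone]
            rcases i with i | i <;> rcases j with j | j
            · simpa [Amat] using cA i j
            · simpa [Amat] using cB i j
            · rw [Subsingleton.elim i 0]; simpa [Amat] using cc j
            · rw [Subsingleton.elim i 0]
              have := cs j
              rw [add_comm] at this
              simpa [Amat] using this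
        rw [Finset.card_insertNone] at this
        omega
    · have hSc : Sᶜ.card = r := by omega
      have hSim : Finset.univ.image f = S := Finset.eq_of_subset_of_card_le hsub (by omega)
      have sumS : ∀ g : Fin (r + 4) → ℝ, ∑ l ∈ S, g l = ∑ i, g (f i) := by
        intro g
        rw [← hSim, Finset.sum_image (fun a _ b _ hab => hinj hab)]
      obtain ⟨k1, k2⟩ := core2 (fun l i => u (f l) (.inr i)) (fun l j => v (f l) (.inr j))
        (fun l i => (hu _ _).1) (fun l i => (hv _ _).1)
        (by
          intro i j
          rw [← sumS (fun l => u l (.inr i) * v l (.inr j)), hB0]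
          refine (Finset.sum_subset (Finset.subset_univ _) (fun l _ hl => ?_)).symm
          by_contra hne
          exact hl ((hS l).2 ⟨i, j, hne⟩))
        hf (fun l => u (f l) (.inl (.inr 0))) (fun l (q : Fin k) => v (f l) (.inl (.inr q)))
        (fun l => (hu _ _).1) (fun l q => (hv _ _).1)
        (fun l i q => hle (h1d i q) (f l)) (fun l j => hle (h1r j) (f l))
      have k1' : ∀ q : Fin k, ∑ l ∈ S, u l (.inl (.inr 0)) * v l (.inl (.inr q)) ≤ 1 := by
        intro q
        rw [sumS]
        exact k1 q
      have hconst : ∀ q q' : Fin k, ∑ l ∈ S, u l (.inl (.inr 0)) * v l (.inl (.inr q)) =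
          ∑ l ∈ S, u l (.inl (.inr 0)) * v l (.inl (.inr q')) := by
        rcases hyp with hyp | hk
        · intro q q'
          rw [sumS, sumS]
          revert q q'
          apply k2
          intro i q
          rw [← sumS (fun l => u l (.inr i) * v l (.inl (.inr q))), h1d]
          refine (Finset.sum_subset (Finset.subset_univ _) (fun l _ hl => ?_)).symm
          suffices hh : u l (.inr i) = 0 by rw [hh, zero_mul]
          by_contra hne
          have hlS : l ∈ Sᶜ := by simpa using hl
          have := rankA (Sᶜ.erase l) (by
            intro l' hl' i' j'
            by_cases hll : l' = l
            · rw [hll, killV l i hne, mul_zero]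
            · have : l' ∈ S := by
                by_contra hn
                exact hl' (Finset.mem_erase.2 ⟨hll, by simpa using hn⟩)
              rw [hSU l' this, zero_mul])
          rw [Finset.card_erase_of_mem hlS] at this
          omega
        · subst hk
          intro q q'
          rw [Subsingleton.elim q q']
      by_cases hk0 : Nonempty (Fin k)
      · obtain ⟨q0⟩ := hk0
        refine ⟨s - ∑ l ∈ S, u l (.inl (.inr 0)) * v l (.inl (.inr q0)), sub_mem hsF (hwF q0),
          ⟨by linarith [k1' q0], by linarith [hw0 q0]⟩, ?_⟩
        refine le_trans (fin _ ?_) hSc.le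
        intro q
        rw [hconst q0 q]
        linarith [cs q]
      · refine ⟨s, hsF, ⟨by linarith, le_refl _⟩, ?_⟩
        exact le_trans (fin _ (fun q => absurd ⟨q⟩ hk0)) hSc.le
  · rintro ⟨ξ, hξF, ⟨hξ1, hξ2⟩, hrk⟩
    obtain ⟨u, v, hu, hv, h⟩ := exists_decomp F _ (hAm ξ (by linarith) hξF) r hrk
    have tF : (s : ℝ) - ξ ∈ F := sub_mem hsF hξF
    have tF' : 1 - ((s : ℝ) - ξ) ∈ F := sub_mem (one_mem F) tF
    have t0 : 0 ≤ (s : ℝ) - ξ := by linarith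
    have t1 : 0 ≤ 1 - ((s : ℝ) - ξ) := by linarith
    generalize ht : (s : ℝ) - ξ = t at *
    have hsx : (s : ℝ) = ξ + t := by linarith
    have := nnRank_le_finset F (Gmat A B c s) (Finset.univ : Finset (Fin r ⊕ Fin 4))
      (Sum.elim (fun l => Sum.elim (u l) (fun _ => 0))
        (fun l => Sum.elim (Sum.elim (fun _ => 0) (fun _ => ![t, 1 - t, t, 1 - t] l))
          (fun i => if i = l then 1 else 0)))
      (Sum.elim (fun l => Sum.elim (v l) (fun _ => 0))
        (fun l => Sum.elim (Sum.elim (fun _ => 0) (fun _ => if l = 0 then 1 else 0))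
          (fun j => B0 l j))) ?_ ?_ ?_
    · simpa using this
    · rintro (l | l) ((i | i) | i)
      · exact hu _ _
      · exact hu _ _
      · exact ⟨le_refl _, zero_mem F⟩
      · exact ⟨le_refl _, zero_mem F⟩
      · fin_cases l
        · exact ⟨t0, tF⟩
        · exact ⟨t1, tF'⟩
        · exact ⟨t0, tF⟩
        · exact ⟨t1, tF'⟩
      · simp only [Sum.elim_inr]
        split_ifs
        · exact ⟨zero_le_one, one_mem F⟩
        · exact ⟨le_refl _, zero_mem F⟩
    · rintro (l | l) ((j | j) | j)
      · exact hv _ _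
      · exact hv _ _
      · exact ⟨le_refl _, zero_mem F⟩
      · exact ⟨le_refl _, zero_mem F⟩
      · simp only [Sum.elim_inr, Sum.elim_inl]
        split_ifs
        · exact ⟨zero_le_one, one_mem F⟩
        · exact ⟨le_refl _, zero_mem F⟩
      · exact hG (.inr l) (.inr j)
    · intro i j
      rw [Fintype.sum_sum_type]
      rcases i with (i | i) | i <;> rcases j with (j | j) | j
      · have := h (.inl i) (.inl j)
        simpa [Gmat, Amat] using this
      · have := h (.inl i) (.inr j)
        simpa [Gmat, Amat] using this
      · simp [Gmat]
      · have := h (.inr i) (.inl j)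
        simpa [Gmat, Amat] using this
      · have := h (.inr i) (.inr j)
        simp only [Sum.elim_inl, Sum.elim_inr, ← this]
        simp [Gmat, Amat, hsx]
      · fin_cases j <;> simp [Gmat, B0, Fin.sum_univ_four]
      · simp [Gmat]
      · simp [Gmat]
      · simp [Gmat]
end

section
/- Let G be a simple graph with finite vertex set V, and let M¹,…,Mʳ be nonnegative real V×V rank-one matrices whose sum M satisfies: M_{vv} = 1 for every v ∈ V, M_{uv} ∈ [0,1] whenever u and v are adjacent in G, and M_{uv} = 0 whenever u ≠ v are non-adjacent in G. Then the sets Vˡ = { v ∈ V : Mˡ_{vv} > 0 } for l = 1,…,r are cliques of G whose union is V. In particular, V can be covered by r cliques of G. -/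
theorem minor_of_rank_one {V : Type*} [Fintype V] (A : Matrix V V ℝ) (h : A.rank = 1) (u v : V) :
    A u v * A v u = A u u * A v v := by
  rw [Matrix.rank_eq_finrank_span_cols, finrank_eq_one_iff'] at h
  obtain ⟨x, -, hx⟩ := h
  have key : ∀ j, ∃ c : ℝ, ∀ i, c * x.1 i = A i j := by
    intro j
    obtain ⟨c, hc⟩ := hx ⟨A.col j, Submodule.subset_span ⟨j, rfl⟩⟩
    refine ⟨c, fun i => ?_⟩
    have := congrFun (congrArg Subtype.val hc) i
    simpa using this
  obtain ⟨c, hc⟩ := key u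
  obtain ⟨d, hd⟩ := key v
  rw [← hc, ← hc, ← hd, ← hd]
  ring

theorem stmt5 {V : Type*} [Fintype V] (G : SimpleGraph V) (r : ℕ)
    (M : Fin r → Matrix V V ℝ)
    (hnn : ∀ l u v, 0 ≤ M l u v) (hrk : ∀ l, (M l).rank = 1)
    (hdiag : ∀ v, (∑ l, M l) v v = 1)
    (hadj : ∀ u v, G.Adj u v → (∑ l, M l) u v ∈ Set.Icc (0 : ℝ) 1)
    (hnon : ∀ u v, u ≠ v → ¬ G.Adj u v → (∑ l, M l) u v = 0) :
    (∀ l, G.IsClique {v | 0 < M l v v}) ∧ (∀ v, ∃ l, 0 < M l v v) ∧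
      ∃ W : Fin r → Set V, (∀ l, G.IsClique (W l)) ∧ ∀ v, ∃ l, v ∈ W l := by
  have h1 : ∀ l, G.IsClique {v | 0 < M l v v} := by
    intro l u hu v hv huv
    by_contra hn
    have h0 := hnon u v huv hn
    rw [Matrix.sum_apply, Finset.sum_eq_zero_iff_of_nonneg (fun l _ => hnn l u v)] at h0
    have h2 := minor_of_rank_one (M l) (hrk l) u v
    rw [h0 l (Finset.mem_univ l), zero_mul] at h2
    exact (mul_pos hu hv).ne h2
  have h2 : ∀ v, ∃ l, 0 < M l v v := by
    intro v
    by_contra! hn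
    have h3 := hdiag v
    rw [Matrix.sum_apply] at h3
    have := Finset.sum_nonpos (fun l (_ : l ∈ Finset.univ) => hn l)
    linarith
  exact ⟨h1, h2, fun l => {v | 0 < M l v v}, h1, h2⟩
end

section
/- Let G be a simple graph with finite vertex set V. Then the clique covering number of G equals the minimum, over all nonnegative real V×V matrices M satisfying M_{vv} = 1 for every v ∈ V, M_{uv} ∈ [0,1] whenever u and v are adjacent in G, and M_{uv} = 0 whenever u ≠ v are non-adjacent in G, of the nonnegative rank of M. -/
/-- The clique covering number of a graph: the smallest number of cliques covering the vertex
set. -/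
noncomputable def cliqueCoverNumber {V : Type*} (G : SimpleGraph V) : ℕ :=
  sInf {c | ∃ U : Fin c → Set V, (∀ i, G.IsClique (U i)) ∧ ∀ v, ∃ i, v ∈ U i}

theorem nnDecomp_exists {V : Type*} [Fintype V] (M : Matrix V V ℝ) (hM : ∀ u v, 0 ≤ M u v) :
    ∃ k, NNDecomp ⊤ M k := by
  classical
  let e := Fintype.equivFin V
  refine ⟨Fintype.card V, fun l i => if e i = l then 1 else 0, fun l j => M (e.symm l) j,
    ?_, ?_, ?_⟩
  · intro l i
    refine ⟨?_, Subfield.mem_top _⟩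
    dsimp only
    split_ifs <;> norm_num
  · intro l j
    exact ⟨hM _ _, Subfield.mem_top _⟩
  · ext i j
    simp [Matrix.sum_apply, Matrix.vecMulVec_apply]

theorem stmt6 {V : Type*} [Fintype V] (G : SimpleGraph V) :
    cliqueCoverNumber G =
      sInf {k | ∃ M : Matrix V V ℝ, (∀ u v, 0 ≤ M u v) ∧
        (∀ v, M v v = 1) ∧
        (∀ u v, G.Adj u v → M u v ∈ Set.Icc (0 : ℝ) 1) ∧
        (∀ u v, u ≠ v → ¬ G.Adj u v → M u v = 0) ∧
        nnRank ⊤ M = k} := by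
  classical
  have hne : {c | ∃ U : Fin c → Set V, (∀ i, G.IsClique (U i)) ∧ ∀ v, ∃ i, v ∈ U i}.Nonempty := by
    refine ⟨Fintype.card V, fun i => {(Fintype.equivFin V).symm i}, fun i => ?_, fun v => ?_⟩
    · simp
    · exact ⟨Fintype.equivFin V v, by simp⟩
  have hcc : ∃ U : Fin (cliqueCoverNumber G) → Set V,
      (∀ i, G.IsClique (U i)) ∧ ∀ v, ∃ i, v ∈ U i := Nat.sInf_mem hne
  obtain ⟨U, hU, hcov⟩ := hcc
  choose f hf using hcov
  let M : Matrix V V ℝ := fun u v => if f u = f v then 1 else 0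
  have hM : ∀ u v, M u v = if f u = f v then 1 else 0 := fun _ _ => rfl
  have hmem : nnRank ⊤ M ∈ {k | ∃ M : Matrix V V ℝ, (∀ u v, 0 ≤ M u v) ∧
        (∀ v, M v v = 1) ∧
        (∀ u v, G.Adj u v → M u v ∈ Set.Icc (0 : ℝ) 1) ∧
        (∀ u v, u ≠ v → ¬ G.Adj u v → M u v = 0) ∧
        nnRank ⊤ M = k} := by
    refine ⟨M, fun u v => ?_, fun v => ?_, fun u v _ => ?_, fun u v huv hadj => ?_, rfl⟩
    · rw [hM]; split_ifs <;> norm_num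
    · simp [hM]
    · rw [hM]; split_ifs <;> norm_num
    · rw [hM, if_neg]
      intro h
      exact hadj (hU (f u) (hf u) (h ▸ hf v) huv)
  apply le_antisymm
  · obtain ⟨N, h0, h1, -, h3, hr⟩ := Nat.sInf_mem ⟨_, hmem⟩
    rw [← hr]
    obtain ⟨a, b, ha, hb, hab⟩ := Nat.sInf_mem (nnDecomp_exists N h0)
    have hN : ∀ x y, N x y = ∑ l, a l x * b l y := by
      intro x y
      conv_lhs => rw [hab]
      simp [Matrix.sum_apply, Matrix.vecMulVec_apply]
    refine Nat.sInf_le ⟨fun l => {v | a l v * b l v ≠ 0}, ?_, ?_⟩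
    · intro l x hx y hy hxy
      by_contra hadj
      have hz := h3 x y hxy hadj
      rw [hN, Finset.sum_eq_zero_iff_of_nonneg
        (fun i _ => mul_nonneg (ha i x).1 (hb i y).1)] at hz
      have := hz l (Finset.mem_univ l)
      exact (mul_ne_zero (left_ne_zero_of_mul hx) (right_ne_zero_of_mul hy)) this
    · intro v
      by_contra! h
      have h1v := h1 v
      rw [hN, Finset.sum_eq_zero] at h1v
      · norm_num at h1v
      · intro l _
        by_contra hl
        exact h l hl
  · refine (Nat.sInf_le hmem).trans (Nat.sInf_le ?_)
    refine ⟨fun l v => if f v = l then 1 else 0, fun l v => if f v = l then 1 else 0, ?_, ?_, ?_⟩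
    · intro l i
      refine ⟨?_, Subfield.mem_top _⟩
      dsimp only
      split_ifs <;> norm_num
    · intro l i
      refine ⟨?_, Subfield.mem_top _⟩
      dsimp only
      split_ifs <;> norm_num
    · ext i j
      rw [hM, Matrix.sum_apply]
      simp only [Matrix.vecMulVec_apply, ite_mul, one_mul, zero_mul]
      rw [Finset.sum_ite_eq, if_pos (Finset.mem_univ _)]
      exact if_congr eq_comm rfl rfl
end

section
/- Let F be a subfield of ℝ. Let ℳ be the explicit 21×21 nonnegative integer matrix given in the paper (its rows, in order, are: (2,2,2,1,0,0,0,0,0,0,0,0,0,0,0,0,0,1,1,1,1), (1,2,1,0,1,0,…,0), (0,0,1,2,0,0,0,0,0,0,0,0,0,1,1,1,1,0,0,0,0), (0,1,0,0,2,0,0,0,0,1,1,1,1,0,0,0,0,0,0,0,0), (0,1,1,2,2,1,1,1,1,0,…,0), (0,0,0,1,1,1,1,0,0,0,…,0), (0,0,0,0,0,0,1,1,0,0,…,0), (0,0,0,0,0,0,0,1,1,0,…,0), (0,0,0,0,0,1,0,0,1,0,…,0), (0,0,0,0,1,0,0,0,0,1,1,0,0,0,…,0), (0,…,0,0,1,1,0,0,…,0)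 with the 1,1 in columns 11,12, (0,…,0,1,1,0,…,0) with the 1,1 in columns 12,13, (0,0,0,0,0,0,0,0,0,1,0,0,1,0,…,0), (0,0,0,1,0,0,0,0,0,0,0,0,0,1,1,0,0,0,0,0,0), (0,…,0,1,1,0,0,0,0,0) with the 1,1 in columns 15,16, (0,…,0,1,1,0,0,0,0) with the 1,1 in columns 16,17, (0,0,0,0,…,0,1,0,0,1,0,0,0,0) with the 1s in columns 14 and 17, (1,0,…,0,1,1,0,0) with the 1s in columns 1,18,19, (0,…,0,0,1,1,0) with the 1,1 in columns 19,20, (0,…,0,0,0,1,1) with the 1,1 in columns 20,21, (0,…,0,1,0,0,1) with the 1s in columns 18 and 21). For a,b,c,d ∈ F, let C(a,b,c,d) be the 5×5 matrix [[a,2,2,1,0],[1,2,1,0,1],[0,0,1,b,0],[0,1,0,0,c],[0,1,1,d,d]]. Then rank_{F+} ℳ ≤ 19 if and only if there exist a,b,c,d ∈ [1,2] ∩ F such that rank_{F+} C(a,b,c,d) ≤ 3. -/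
/-- The explicit 21 × 21 matrix ℳ of the paper. -/
def Mcal (K : Type*) [Zero K] [One K] [OfNat K 2] : Matrix (Fin 21) (Fin 21) K :=
  Matrix.of
    ![![2,2,2,1,0,0,0,0,0,0,0,0,0,0,0,0,0,1,1,1,1],
      ![1,2,1,0,1,0,0,0,0,0,0,0,0,0,0,0,0,0,0,0,0],
      ![0,0,1,2,0,0,0,0,0,0,0,0,0,1,1,1,1,0,0,0,0],
      ![0,1,0,0,2,0,0,0,0,1,1,1,1,0,0,0,0,0,0,0,0],
      ![0,1,1,2,2,1,1,1,1,0,0,0,0,0,0,0,0,0,0,0,0],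
      ![0,0,0,1,1,1,1,0,0,0,0,0,0,0,0,0,0,0,0,0,0],
      ![0,0,0,0,0,0,1,1,0,0,0,0,0,0,0,0,0,0,0,0,0],
      ![0,0,0,0,0,0,0,1,1,0,0,0,0,0,0,0,0,0,0,0,0],
      ![0,0,0,0,0,1,0,0,1,0,0,0,0,0,0,0,0,0,0,0,0],
      ![0,0,0,0,1,0,0,0,0,1,1,0,0,0,0,0,0,0,0,0,0],
      ![0,0,0,0,0,0,0,0,0,0,1,1,0,0,0,0,0,0,0,0,0],
      ![0,0,0,0,0,0,0,0,0,0,0,1,1,0,0,0,0,0,0,0,0],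
      ![0,0,0,0,0,0,0,0,0,1,0,0,1,0,0,0,0,0,0,0,0],
      ![0,0,0,1,0,0,0,0,0,0,0,0,0,1,1,0,0,0,0,0,0],
      ![0,0,0,0,0,0,0,0,0,0,0,0,0,0,1,1,0,0,0,0,0],
      ![0,0,0,0,0,0,0,0,0,0,0,0,0,0,0,1,1,0,0,0,0],
      ![0,0,0,0,0,0,0,0,0,0,0,0,0,1,0,0,1,0,0,0,0],
      ![1,0,0,0,0,0,0,0,0,0,0,0,0,0,0,0,0,1,1,0,0],
      ![0,0,0,0,0,0,0,0,0,0,0,0,0,0,0,0,0,0,1,1,0],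
      ![0,0,0,0,0,0,0,0,0,0,0,0,0,0,0,0,0,0,0,1,1],
      ![0,0,0,0,0,0,0,0,0,0,0,0,0,0,0,0,0,1,0,0,1]]

/-- The 5 × 5 matrix 𝒞(a,b,c,d) of the paper. -/
def Cmat (a b c d : ℝ) : Matrix (Fin 5) (Fin 5) ℝ :=
  !![a,2,2,1,0;
     1,2,1,0,1;
     0,0,1,b,0;
     0,1,0,0,c;
     0,1,1,d,d]

set_option maxHeartbeats 4000000 in
theorem Mcal_cast (i j : Fin 21) : Mcal ℝ i j = ((Mcal ℕ i j : ℕ) : ℝ) := by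
  fin_cases i <;> fin_cases j <;> simp [Mcal]

theorem NNDecomp.of_fintype {F : Subfield ℝ} {m n ι : Type*} [Fintype ι] {A : Matrix m n ℝ}
    (u : ι → m → ℝ) (v : ι → n → ℝ)
    (hu : ∀ l i, 0 ≤ u l i ∧ u l i ∈ F) (hv : ∀ l j, 0 ≤ v l j ∧ v l j ∈ F)
    (h : ∀ i j, A i j = ∑ l, u l i * v l j) : NNDecomp F A (Fintype.card ι) := by
  let e := (Fintype.equivFin ι).symm
  refine ⟨fun l => u (e l), fun l => v (e l), fun l i => hu _ i, fun l j => hv _ j, ?_⟩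
  ext i j
  rw [h, Matrix.sum_apply, ← Equiv.sum_comp e]
  rfl

theorem NNDecomp.mono {F : Subfield ℝ} {m n : Type*} {A : Matrix m n ℝ} {k k' : ℕ}
    (h : NNDecomp F A k) (hk : k ≤ k') : NNDecomp F A k' := by
  obtain ⟨u, v, hu, hv, rfl⟩ := h
  obtain ⟨r, rfl⟩ := Nat.exists_eq_add_of_le hk
  have := NNDecomp.of_fintype (F := F) (ι := Fin k ⊕ Fin r)
    (A := ∑ l, Matrix.vecMulVec (u l) (v l))
    (Sum.elim u fun _ _ => 0) (Sum.elim v fun _ _ => 0)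
    (by rintro (l | l) i
        · exact hu l i
        · exact ⟨le_rfl, F.zero_mem⟩)
    (by rintro (l | l) i
        · exact hv l i
        · exact ⟨le_rfl, F.zero_mem⟩)
    (by intro i j
        simp [Matrix.sum_apply, Matrix.vecMulVec_apply])
  simpa using this

theorem NNDecomp.exists_of_nonneg {F : Subfield ℝ} {m n : Type*} [Fintype m] [DecidableEq m]
    {A : Matrix m n ℝ} (h : ∀ i j, 0 ≤ A i j ∧ A i j ∈ F) : NNDecomp F A (Fintype.card m) := by
  refine NNDecomp.of_fintype (fun l i => if i = l then 1 else 0) (fun l j => A l j) ?_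
    (fun l j => h l j) ?_
  · intro l i
    split_ifs
    · exact ⟨zero_le_one, F.one_mem⟩
    · exact ⟨le_rfl, F.zero_mem⟩
  · intro i j
    simp

theorem nnRank_le_iff {F : Subfield ℝ} {m n : Type*} [Fintype m] [DecidableEq m]
    {A : Matrix m n ℝ} (h : ∀ i j, 0 ≤ A i j ∧ A i j ∈ F) (k : ℕ) :
    nnRank F A ≤ k ↔ NNDecomp F A k := by
  constructor
  · intro hk
    have : NNDecomp F A (nnRank F A) :=
      Nat.sInf_mem (s := {k | NNDecomp F A k}) ⟨_, NNDecomp.exists_of_nonneg h⟩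
    exact this.mono hk
  · intro hk
    exact Nat.sInf_le hk

/-- Any fooling set whose size equals the number of terms is matched bijectively to the terms. -/
theorem fooling {m n ι : Type*} [Fintype ι] {k : ℕ} (hk : Fintype.card ι = k)
    {A : m → n → ℝ} {u : Fin k → m → ℝ} {v : Fin k → n → ℝ}
    (hu : ∀ l i, 0 ≤ u l i) (hv : ∀ l j, 0 ≤ v l j)
    (h : ∀ i j, A i j = ∑ l, u l i * v l j)
    (f : ι → m × n) (h0 : ∀ x, A (f x).1 (f x).2 ≠ 0)
    (h1 : ∀ x y, x ≠ y → A (f x).1 (f y).2 = 0 ∨ A (f y).1 (f x).2 = 0) :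
    ∃ σ : ι ≃ Fin k, ∀ x, 0 < u (σ x) (f x).1 ∧ 0 < v (σ x) (f x).2 := by
  have key : ∀ x, ∃ l, 0 < u l (f x).1 ∧ 0 < v l (f x).2 := by
    intro x
    have := h0 x
    rw [h] at this
    obtain ⟨l, -, hl⟩ := Finset.exists_ne_zero_of_sum_ne_zero this
    exact ⟨l, lt_of_le_of_ne (hu _ _) (Ne.symm (left_ne_zero_of_mul hl)),
      lt_of_le_of_ne (hv _ _) (Ne.symm (right_ne_zero_of_mul hl))⟩
  choose σ hσ using key
  have pos : ∀ l i j, 0 < u l i → 0 < v l j → A i j ≠ 0 := by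
    intro l i j h1 h2 h3
    rw [h, Finset.sum_eq_zero_iff_of_nonneg (fun l _ => mul_nonneg (hu _ _) (hv _ _))] at h3
    exact (mul_pos h1 h2).ne' (h3 l (Finset.mem_univ _))
  have inj : Function.Injective σ := by
    intro x y hxy
    by_contra hne
    rcases h1 x y hne with h2 | h2
    · exact pos (σ x) _ _ (hσ x).1 (by rw [hxy]; exact (hσ y).2) h2
    · exact pos (σ x) _ _ (by rw [hxy]; exact (hσ y).1) (hσ x).2 h2
  have bij : Function.Bijective σ :=
    (Fintype.bijective_iff_injective_and_card σ).2 ⟨inj, by simpa using hk⟩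
  exact ⟨Equiv.ofBijective σ bij, hσ⟩

/-- index of the `k`-th gadget row -/
def gp (k : Fin 16) : Fin 21 := Fin.natAdd 5 k

def fool1 : Fin 3 ⊕ Fin 16 → Fin 21 × Fin 21 :=
  Sum.elim ![(1, 0), (2, 2), (3, 1)] (fun k => (gp k, gp k))

def fool2 : Fin 3 ⊕ Fin 16 → Fin 21 × Fin 21 :=
  Sum.elim ![(0, 1), (1, 4), (2, 2)] (fun k => (gp k, gp k))

theorem fool1_ne : ∀ x, Mcal ℕ (fool1 x).1 (fool1 x).2 ≠ 0 := by decide +kernel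
theorem fool2_ne : ∀ x, Mcal ℕ (fool2 x).1 (fool2 x).2 ≠ 0 := by decide +kernel
theorem fool1_zero : ∀ x y, x ≠ y → Mcal ℕ (fool1 x).1 (fool1 y).2 = 0 ∨
    Mcal ℕ (fool1 y).1 (fool1 x).2 = 0 := by decide +kernel
theorem fool2_zero : ∀ x y, x ≠ y → Mcal ℕ (fool2 x).1 (fool2 y).2 = 0 ∨
    Mcal ℕ (fool2 y).1 (fool2 x).2 = 0 := by decide +kernel

theorem row1 : ∀ k, Mcal ℕ 1 (gp k) = 0 := by decide +kernel

theorem Mcal_mem (F : Subfield ℝ) (i j : Fin 21) : 0 ≤ Mcal ℝ i j ∧ Mcal ℝ i j ∈ F := by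
  rw [Mcal_cast]
  exact ⟨Nat.cast_nonneg _, natCast_mem F _⟩

theorem Cmat_mem (F : Subfield ℝ) {a b c d : ℝ} (ha : a ∈ F) (hb : b ∈ F) (hc : c ∈ F) (hd : d ∈ F)
    (ha' : a ∈ Set.Icc (1 : ℝ) 2) (hb' : b ∈ Set.Icc (1 : ℝ) 2) (hc' : c ∈ Set.Icc (1 : ℝ) 2)
    (hd' : d ∈ Set.Icc (1 : ℝ) 2) (i j : Fin 5) :
    0 ≤ Cmat a b c d i j ∧ Cmat a b c d i j ∈ F := by
  have a0 : 0 ≤ a := by linarith [ha'.1]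
  have b0 : 0 ≤ b := by linarith [hb'.1]
  have c0 : 0 ≤ c := by linarith [hc'.1]
  have d0 : 0 ≤ d := by linarith [hd'.1]
  have h2 : (2 : ℝ) ∈ F := by exact_mod_cast natCast_mem F 2
  fin_cases i <;> fin_cases j <;> simp [Cmat, F.zero_mem, F.one_mem, *]

set_option maxHeartbeats 4000000 in
theorem forward_dir (F : Subfield ℝ) (h : NNDecomp F (Mcal ℝ) 19) :
    ∃ a b c d : ℝ, a ∈ F ∧ b ∈ F ∧ c ∈ F ∧ d ∈ F ∧
        a ∈ Set.Icc (1 : ℝ) 2 ∧ b ∈ Set.Icc (1 : ℝ) 2 ∧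
        c ∈ Set.Icc (1 : ℝ) 2 ∧ d ∈ Set.Icc (1 : ℝ) 2 ∧
        NNDecomp F (Cmat a b c d) 3 := by
  obtain ⟨u, v, hu, hv, hM⟩ := h
  have hM' : ∀ i j, Mcal ℝ i j = ∑ l, u l i * v l j := by
    intro i j
    rw [hM, Matrix.sum_apply]
    rfl
  have pos : ∀ l i j, Mcal ℕ i j = 0 → 0 < u l i → 0 < v l j → False := by
    intro l i j h3 h1 h2
    have h4 := hM' i j
    rw [Mcal_cast, h3, Nat.cast_zero, eq_comm,
      Finset.sum_eq_zero_iff_of_nonneg (fun l _ => mul_nonneg (hu _ _).1 (hv _ _).1)] at h4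
    exact (mul_pos h1 h2).ne' (h4 l (Finset.mem_univ _))
  obtain ⟨σ, hσ⟩ := fooling (by simp) (fun l i => (hu l i).1) (fun l j => (hv l j).1) hM' fool1
    (by intro x; rw [Mcal_cast]; exact_mod_cast fool1_ne x)
    (by intro x y hxy; simp only [Mcal_cast]; exact_mod_cast fool1_zero x y hxy)
  obtain ⟨τ, hτ⟩ := fooling (by simp) (fun l i => (hu l i).1) (fun l j => (hv l j).1) hM' fool2
    (by intro x; rw [Mcal_cast]; exact_mod_cast fool2_ne x)
    (by intro x y hxy; simp only [Mcal_cast]; exact_mod_cast fool2_zero x y hxy)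
  -- the terms of the core and of the gadgets
  obtain ⟨U, hU⟩ : ∃ U : Fin 3 → Fin 21 → ℝ, U = fun l => u (σ (.inl l)) := ⟨_, rfl⟩
  obtain ⟨V, hV⟩ : ∃ V : Fin 3 → Fin 21 → ℝ, V = fun l => v (σ (.inl l)) := ⟨_, rfl⟩
  obtain ⟨P, hP⟩ : ∃ P : Fin 16 → Fin 21 → ℝ, P = fun l => u (σ (.inr l)) := ⟨_, rfl⟩
  obtain ⟨Q, hQ⟩ : ∃ Q : Fin 16 → Fin 21 → ℝ, Q = fun l => v (σ (.inr l)) := ⟨_, rfl⟩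
  have hsum : ∀ i j, Mcal ℝ i j = ∑ l, U l i * V l j + ∑ k, P k i * Q k j := by
    intro i j
    rw [hM', ← Equiv.sum_comp σ, Fintype.sum_sum_type, hU, hV, hP, hQ]
  have U0 : ∀ l i, 0 ≤ U l i ∧ U l i ∈ F := by intro l i; rw [hU]; exact hu _ _
  have V0 : ∀ l i, 0 ≤ V l i ∧ V l i ∈ F := by intro l i; rw [hV]; exact hv _ _
  have P0 : ∀ l i, 0 ≤ P l i ∧ P l i ∈ F := by intro l i; rw [hP]; exact hu _ _
  have Q0 : ∀ l i, 0 ≤ Q l i ∧ Q l i ∈ F := by intro l i; rw [hQ]; exact hv _ _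
  have Pz : ∀ k i, Mcal ℕ i (gp k) = 0 → P k i = 0 := by
    intro k i hi
    by_contra hne
    refine pos (σ (.inr k)) i (gp k) hi ?_ (hσ (.inr k)).2
    have := lt_of_le_of_ne (P0 k i).1 (Ne.symm hne)
    rwa [hP] at this
  have Qz : ∀ k j, Mcal ℕ (gp k) j = 0 → Q k j = 0 := by
    intro k j hj
    by_contra hne
    refine pos (σ (.inr k)) (gp k) j hj (hσ (.inr k)).1 ?_
    have := lt_of_le_of_ne (Q0 k j).1 (Ne.symm hne)
    rwa [hQ] at this
  have Uz : ∀ l i j, 0 < V l j → Mcal ℕ i j = 0 → U l i = 0 := by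
    intro l i j hj hij
    by_contra hne
    have h1 := lt_of_le_of_ne (U0 l i).1 (Ne.symm hne)
    rw [hU] at h1
    rw [hV] at hj
    exact pos _ i j hij h1 hj
  have V00 : 0 < V 0 0 := by rw [hV]; exact (hσ (.inl 0)).2
  have V12 : 0 < V 1 2 := by rw [hV]; exact (hσ (.inl 1)).2
  have V21 : 0 < V 2 1 := by rw [hV]; exact (hσ (.inl 2)).2
  have V0' : 0 < V 0 1 ∨ 0 < V 0 4 ∨ 0 < V 0 2 := by
    obtain ⟨x, hx⟩ := τ.surjective (σ (.inl 0))
    have h2 := (hτ x).2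
    rw [hx] at h2
    rw [hV]
    rcases x with x | k
    · fin_cases x
      · exact .inl h2
      · exact .inr (.inl h2)
      · exact .inr (.inr h2)
    · exact (pos _ 1 (gp k) (row1 k) (hσ (.inl 0)).1 h2).elim
  have U5 : ∀ i : Fin 21, i = 5 ∨ i = 9 ∨ i = 13 → ∀ l, U l i = 0 := by
    intro i hi l
    fin_cases l
    · exact Uz 0 i 0 V00 (by rcases hi with rfl | rfl | rfl <;> rfl)
    · exact Uz 1 i 2 V12 (by rcases hi with rfl | rfl | rfl <;> rfl)
    · exact Uz 2 i 1 V21 (by rcases hi with rfl | rfl | rfl <;> rfl)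
  have U17 : ∀ l, U l 17 = 0 := by
    intro l
    fin_cases l
    · rcases V0' with h | h | h
      · exact Uz 0 17 _ h rfl
      · exact Uz 0 17 _ h rfl
      · exact Uz 0 17 _ h rfl
    · exact Uz 1 17 2 V12 rfl
    · exact Uz 2 17 1 V21 rfl
  -- entries in the head row of a gadget
  have row : ∀ (k : Fin 16) (s : Fin 21), (∀ l, U l (gp k) = 0) →
      (∀ k', k' ≠ k → Mcal ℕ (gp k) (gp k') = 0 ∨ Mcal ℕ (gp k') s = 0) →
      Mcal ℕ (gp k) s = 1 → P k (gp k) * Q k s = 1 := by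
    intro k s h1 h2 h3
    have h4 := hsum (gp k) s
    rw [Finset.sum_eq_zero (fun l _ => by rw [h1, zero_mul]), zero_add,
      Finset.sum_eq_single k, Mcal_cast, h3] at h4
    · simpa using h4.symm
    · intro k' _ hk'
      rcases h2 k' hk' with h | h
      · rw [Pz _ _ h, zero_mul]
      · rw [Qz _ _ h, mul_zero]
    · simp
  -- the contribution of a gadget to the core
  have gad : ∀ (k : Fin 16) (s r : Fin 21), (∀ l, U l (gp k) = 0) →
      (∀ k', k' ≠ k → Mcal ℕ (gp k) (gp k') = 0 ∨ Mcal ℕ (gp k') s = 0) →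
      Mcal ℕ (gp k) s = 1 → 
      (∀ k', k' ≠ k → Mcal ℕ (gp k) (gp k') = 0 ∨ Mcal ℕ (gp k') (gp k) = 0) →
      Mcal ℕ (gp k) (gp k) = 1 → Mcal ℕ r (gp k) = 1 →
      Q k s = Q k (gp k) ∧ P k r * Q k (gp k) ≤ 1 := by
    intro k s r h1 h2 h3 h4 h5 h6
    have e1 := row k s h1 h2 h3
    have e2 := row k (gp k) h1 h4 h5
    have hne : P k (gp k) ≠ 0 := by
      intro h; rw [h, zero_mul] at e1; exact zero_ne_one e1
    refine ⟨mul_left_cancel₀ hne (e1.trans e2.symm), ?_⟩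
    have e3 := hsum r (gp k)
    rw [Mcal_cast, h6, Nat.cast_one] at e3
    have e4 : 0 ≤ ∑ l, U l r * V l (gp k) :=
      Finset.sum_nonneg fun l _ => mul_nonneg (U0 _ _).1 (V0 _ _).1
    have e5 : P k r * Q k (gp k) ≤ ∑ k', P k' r * Q k' (gp k) :=
      Finset.single_le_sum (f := fun k' => P k' r * Q k' (gp k))
        (fun l _ => mul_nonneg (P0 _ _).1 (Q0 _ _).1) (Finset.mem_univ k)
    linarith
  obtain ⟨d1, d2⟩ := gad 0 3 4 (U5 5 (by simp)) (by decide +kernel) rfl (by decide +kernel) rfl rfl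
  obtain ⟨d3, -⟩ := gad 0 4 4 (U5 5 (by simp)) (by decide +kernel) rfl (by decide +kernel) rfl rfl
  obtain ⟨c1, c2⟩ := gad 4 4 3 (U5 9 (by simp)) (by decide +kernel) rfl (by decide +kernel) rfl rfl
  obtain ⟨b1, b2⟩ := gad 8 3 2 (U5 13 (by simp)) (by decide +kernel) rfl (by decide +kernel) rfl rfl
  obtain ⟨a1, a2⟩ := gad 12 0 0 U17 (by decide +kernel) rfl (by decide +kernel) rfl rfl
  have mem2 : (2 : ℝ) ∈ F := by exact_mod_cast natCast_mem F 2
  have mm : ∀ k r s, 2 - P k r * Q k s ∈ F := fun k r s =>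
    F.sub_mem mem2 (F.mul_mem (P0 _ _).2 (Q0 _ _).2)
  have ii : ∀ k r s, P k r * Q k s ≤ 1 → 2 - P k r * Q k s ∈ Set.Icc (1 : ℝ) 2 := by
    intro k r s h
    have := mul_nonneg (P0 k r).1 (Q0 k s).1
    constructor <;> linarith
  refine ⟨2 - P 12 0 * Q 12 0, 2 - P 8 2 * Q 8 3, 2 - P 4 3 * Q 4 4, 2 - P 0 4 * Q 0 3,
    mm _ _ _, mm _ _ _, mm _ _ _, mm _ _ _, ii _ _ _ (by rwa [a1]), ii _ _ _ (by rwa [b1]),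
    ii _ _ _ (by rwa [c1]), ii _ _ _ (by rwa [d1]), ?_⟩
  have fin := NNDecomp.of_fintype (F := F) (ι := Fin 3)
    (A := Cmat (2 - P 12 0 * Q 12 0) (2 - P 8 2 * Q 8 3) (2 - P 4 3 * Q 4 4) (2 - P 0 4 * Q 0 3))
    (fun l i => U l (Fin.castLE (by norm_num) i)) (fun l i => V l (Fin.castLE (by norm_num) i))
    (fun l i => U0 _ _) (fun l i => V0 _ _) ?_
  · simpa using fin
  intro i j
  have e := hsum (Fin.castLE (by norm_num) i) (Fin.castLE (by norm_num) j)
  have z : ∀ k, P k (Fin.castLE (by norm_num) i) * Q k (Fin.castLE (by norm_num) j) =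
      if Mcal ℕ (Fin.castLE (by norm_num) i) (gp k) = 0 ∨
        Mcal ℕ (gp k) (Fin.castLE (by norm_num) j) = 0 then 0
      else P k (Fin.castLE (by norm_num) i) * Q k (Fin.castLE (by norm_num) j) := by
    intro k
    split_ifs with h
    · rcases h with h | h
      · rw [Pz _ _ h, zero_mul]
      · rw [Qz _ _ h, mul_zero]
    · rfl
  have d4 : Q 0 4 = Q 0 3 := by rw [d1, d3]
  rw [← sub_eq_iff_eq_add, Finset.sum_congr rfl (fun k _ => z k)] at e
  rw [← e, Mcal_cast]
  clear e z
  fin_cases i <;> fin_cases j <;> 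
    simp [Fin.sum_univ_succ, Mcal, gp, Cmat, d4, Fin.natAdd, Fin.castLE]

/-- the core row attached to the gadget of the `k`-th gadget row -/
def grr : Fin 16 → Fin 5 := ![4, 4, 4, 4, 3, 3, 3, 3, 2, 2, 2, 2, 0, 0, 0, 0]

set_option maxHeartbeats 4000000 in
theorem backward_dir (F : Subfield ℝ) {a b c d : ℝ}
    (ha : a ∈ F) (hb : b ∈ F) (hc : c ∈ F) (hd : d ∈ F)
    (ha' : a ∈ Set.Icc (1 : ℝ) 2) (hb' : b ∈ Set.Icc (1 : ℝ) 2) (hc' : c ∈ Set.Icc (1 : ℝ) 2)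
    (hd' : d ∈ Set.Icc (1 : ℝ) 2) (h : NNDecomp F (Cmat a b c d) 3) :
    NNDecomp F (Mcal ℝ) 19 := by
  obtain ⟨u, v, hu, hv, hC⟩ := h
  have hC' : ∀ i j, Cmat a b c d i j = ∑ l, u l i * v l j := by
    intro i j
    rw [hC, Matrix.sum_apply]
    rfl
  have h2 : (2 : ℝ) ∈ F := by exact_mod_cast natCast_mem F 2
  obtain ⟨t, ht⟩ : ∃ t : Fin 16 → ℝ, t = ![2 - d, d - 1, 2 - d, d - 1, 2 - c, c - 1, 2 - c, c - 1,
    2 - b, b - 1, 2 - b, b - 1, 2 - a, a - 1, 2 - a, a - 1] := ⟨_, rfl⟩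
  have ht0 : ∀ k, 0 ≤ t k ∧ t k ∈ F := by
    have key : ∀ x ∈ F, x ∈ Set.Icc (1 : ℝ) 2 →
        (0 ≤ 2 - x ∧ 2 - x ∈ F) ∧ (0 ≤ x - 1 ∧ x - 1 ∈ F) := by
      intro x hx hx'
      exact ⟨⟨by linarith [hx'.2], F.sub_mem h2 hx⟩, ⟨by linarith [hx'.1], F.sub_mem hx F.one_mem⟩⟩
    intro k
    rw [ht]
    fin_cases k
    exacts [(key d hd hd').1, (key d hd hd').2, (key d hd hd').1, (key d hd hd').2,
      (key c hc hc').1, (key c hc hc').2, (key c hc hc').1, (key c hc hc').2,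
      (key b hb hb').1, (key b hb hb').2, (key b hb hb').1, (key b hb hb').2,
      (key a ha ha').1, (key a ha ha').2, (key a ha ha').1, (key a ha ha').2]
  have fin := NNDecomp.of_fintype (F := F) (ι := Fin 3 ⊕ Fin 16) (A := Mcal ℝ)
    (Sum.elim (fun l => Fin.append (m := 5) (n := 16) (u l) (fun _ => 0))
      (fun k => Fin.append (m := 5) (n := 16) (fun i => if i = grr k then t k else 0)
        (fun i => if i = k then 1 else 0)))
    (Sum.elim (fun l => Fin.append (m := 5) (n := 16) (v l) (fun _ => 0))
      (fun k => Mcal ℝ (gp k))) ?_ ?_ ?_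
  · simpa using fin
  · rintro (l | k) i
    · induction i using Fin.addCases (m := 5) (n := 16) with
      | left i => simpa only [Sum.elim_inl, Fin.append_left] using hu l i
      | right i => simpa only [Sum.elim_inl, Fin.append_right] using ⟨le_rfl, F.zero_mem⟩
    · induction i using Fin.addCases (m := 5) (n := 16) with
      | left i =>
        simp only [Sum.elim_inr, Fin.append_left]
        split_ifs
        · exact ht0 k
        · exact ⟨le_rfl, F.zero_mem⟩
      | right i =>
        simp only [Sum.elim_inr, Fin.append_right]
        split_ifs
        · exact ⟨zero_le_one, F.one_mem⟩
        · exact ⟨le_rfl, F.zero_mem⟩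
  · rintro (l | k) i
    · induction i using Fin.addCases (m := 5) (n := 16) with
      | left i => simpa only [Sum.elim_inl, Fin.append_left] using hv l i
      | right i => simpa only [Sum.elim_inl, Fin.append_right] using ⟨le_rfl, F.zero_mem⟩
    · exact Mcal_mem F _ _
  · intro i j
    rw [Fintype.sum_sum_type]
    simp only [Sum.elim_inl, Sum.elim_inr]
    induction i using Fin.addCases (m := 5) (n := 16) with
    | right i =>
      simp only [Fin.append_right, zero_mul, Finset.sum_const_zero, ite_mul, one_mul, zero_add,
        Finset.sum_ite_eq, Finset.mem_univ, if_true]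
      rfl
    | left i =>
      induction j using Fin.addCases (m := 5) (n := 16) with
      | left j =>
        simp only [Fin.append_left]
        rw [← hC']
        clear hC hC' hu hv ht0
        subst ht
        fin_cases i <;> fin_cases j <;>
          simp [Fin.sum_univ_succ, Mcal, gp, grr, Cmat, Fin.natAdd, Fin.castAdd, Fin.castLE]
      | right j =>
        simp only [Fin.append_left, Fin.append_right, mul_zero, Finset.sum_const_zero, zero_add]
        clear hC hC' hu hv ht0
        subst ht
        fin_cases i <;> fin_cases j <;>
          simp [Fin.sum_univ_succ, Mcal, gp, grr, Fin.natAdd, Fin.castAdd, Fin.castLE] <;> ring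

theorem stmt7 (F : Subfield ℝ) :
    nnRank F (Mcal ℝ) ≤ 19 ↔
      ∃ a b c d : ℝ, a ∈ F ∧ b ∈ F ∧ c ∈ F ∧ d ∈ F ∧
        a ∈ Set.Icc (1 : ℝ) 2 ∧ b ∈ Set.Icc (1 : ℝ) 2 ∧
        c ∈ Set.Icc (1 : ℝ) 2 ∧ d ∈ Set.Icc (1 : ℝ) 2 ∧
        nnRank F (Cmat a b c d) ≤ 3 := by
  rw [nnRank_le_iff (Mcal_mem F)]
  constructor
  · intro h
    obtain ⟨a, b, c, d, ha, hb, hc, hd, ha', hb', hc', hd', h⟩ := forward_dir F h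
    exact ⟨a, b, c, d, ha, hb, hc, hd, ha', hb', hc', hd',
      (nnRank_le_iff (Cmat_mem F ha hb hc hd ha' hb' hc' hd') 3).2 h⟩
  · rintro ⟨a, b, c, d, ha, hb, hc, hd, ha', hb', hc', hd', h⟩
    exact backward_dir F ha hb hc hd ha' hb' hc' hd'
      ((nnRank_le_iff (Cmat_mem F ha hb hc hd ha' hb' hc' hd') 3).1 h)
end

section
/- Let a,b,c,d be real numbers and let C(a,b,c,d) be the 5×5 real matrix [[a,2,2,1,0],[1,2,1,0,1],[0,0,1,b,0],[0,1,0,0,c],[0,1,1,d,d]]. If the (conventional) rank of C(a,b,c,d) is at most 3, then b = c = d, b = 1 + √(1/2) or b = 1 − √(1/2), and a = 2 − 1/b. -/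
theorem minor_zero (A : Matrix (Fin 5) (Fin 5) ℝ) (h : A.rank ≤ 3) (f g : Fin 4 → Fin 5) :
    (A.submatrix f g).det = 0 := by
  by_contra hd
  have h1 := Matrix.rank_of_isUnit (A.submatrix f g)
    ((Matrix.isUnit_iff_isUnit_det _).2 (isUnit_iff_ne_zero.2 hd))
  have h2 := Matrix.rank_submatrix_le A f g
  simp at h1
  omega

theorem stmt8 (a b c d : ℝ) (h : (Cmat a b c d).rank ≤ 3) :
    b = c ∧ c = d ∧
      (b = 1 + Real.sqrt (1/2) ∨ b = 1 - Real.sqrt (1/2)) ∧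
      a = 2 - 1/b := by
  have m := minor_zero _ h
  have h1 : (!![1, 2, 1, 0; 0, 0, 1, b; 0, 1, 0, 0; 0, 1, 1, d] : Matrix (Fin 4) (Fin 4) ℝ).det = 0 := by
    refine Eq.trans ?_ (m ![1, 2, 3, 4] ![0, 1, 2, 3])
    congr 1
    ext i j
    fin_cases i <;> fin_cases j <;> rfl
  have h2 : (!![1, 2, 1, 1; 0, 0, 1, 0; 0, 1, 0, c; 0, 1, 1, d] : Matrix (Fin 4) (Fin 4) ℝ).det = 0 := by
    refine Eq.trans ?_ (m ![1, 2, 3, 4] ![0, 1, 2, 4])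
    congr 1
    ext i j
    fin_cases i <;> fin_cases j <;> rfl
  have h3 : (!![a, 2, 2, 1; 1, 2, 1, 0; 0, 0, 1, b; 0, 1, 0, 0] : Matrix (Fin 4) (Fin 4) ℝ).det = 0 := by
    refine Eq.trans ?_ (m ![0, 1, 2, 3] ![0, 1, 2, 3])
    congr 1
    ext i j
    fin_cases i <;> fin_cases j <;> rfl
  have h4 : (!![a, 2, 2, 0; 1, 2, 1, 1; 0, 0, 1, 0; 0, 1, 0, c] : Matrix (Fin 4) (Fin 4) ℝ).det = 0 := by
    refine Eq.trans ?_ (m ![0, 1, 2, 3] ![0, 1, 2, 4])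
    congr 1
    ext i j
    fin_cases i <;> fin_cases j <;> rfl
  simp [Matrix.det_succ_row_zero, Fin.sum_univ_succ, Fin.succAbove] at h1 h2 h3 h4
  have e1 : d = b := by linarith
  have e2 : d = c := by linarith
  have e3 : (2 - a) * b = 1 := by linarith
  have e4 : a + (2 - 2 * a) * c = 0 := by linarith
  subst e1
  subst e2
  have hb : d ≠ 0 := by rintro rfl; simp at e3
  have hq : (d - 1) ^ 2 = 1 / 2 := by
    have : 2 * d ^ 2 - 4 * d + 1 = 0 := by linear_combination -d * e4 - (1 - 2 * d) * e3
    linarith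
  have hs : Real.sqrt (1/2) ^ 2 = 1 / 2 := Real.sq_sqrt (by norm_num)
  refine ⟨rfl, rfl, ?_, ?_⟩
  · rcases sq_eq_sq_iff_eq_or_eq_neg.1 (hq.trans hs.symm) with h | h
    · left; linarith
    · right; linarith
  · field_simp
    linarith
end

section
/- Let α = 1 + √(1/2) and let C = [[√2,2,2,1,0],[1,2,1,0,1],[0,0,1,α,0],[0,1,0,0,α],[0,1,1,α,α]] (i.e., C = C(√2,α,α,α,α)). Then C is the sum of the three nonnegative rank-one 5×5 matrices M₁ = [[0,0,0,0,0],[0,α⁻¹,0,0,1],[0,0,0,0,0],[0,1,0,0,α],[0,1,0,0,α]], M₂ = [[0,0,α⁻¹,1,0],[0,0,0,0,0],[0,0,1,α,0],[0,0,0,0,0],[0,0,1,α,0]], and M₃ = [[√2,2,√2,0,0],[1,√2,1,0,0],[0,0,0,0,0],[0,0,0,0,0],[0,0,0,0,0]]; in particular each Mᵢ is nonnegative and has rank one, and consequently the nonnegative rank of C over ℝ is at most 3. -/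
noncomputable def alph : ℝ := 1 + Real.sqrt (1/2)

noncomputable def M1 : Matrix (Fin 5) (Fin 5) ℝ :=
  !![0,0,0,0,0;
     0,alph⁻¹,0,0,1;
     0,0,0,0,0;
     0,1,0,0,alph;
     0,1,0,0,alph]

noncomputable def M2 : Matrix (Fin 5) (Fin 5) ℝ :=
  !![0,0,alph⁻¹,1,0;
     0,0,0,0,0;
     0,0,1,alph,0;
     0,0,0,0,0;
     0,0,1,alph,0]

noncomputable def M3 : Matrix (Fin 5) (Fin 5) ℝ :=
  !![Real.sqrt 2,2,Real.sqrt 2,0,0;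
     1,Real.sqrt 2,1,0,0;
     0,0,0,0,0;
     0,0,0,0,0;
     0,0,0,0,0]

lemma sqrt_two_sq_aux : Real.sqrt 2 * Real.sqrt 2 = 2 := Real.mul_self_sqrt (by norm_num)

lemma alph_eq : alph = 1 + Real.sqrt 2 / 2 := by
  unfold alph
  have h : Real.sqrt (1/2) = Real.sqrt 2 / 2 := by
    rw [Real.sqrt_eq_iff_mul_self_eq (by norm_num) (by positivity)]
    nlinarith [sqrt_two_sq_aux]
  rw [h]

lemma alph_pos : 0 < alph := by
  rw [alph_eq]; positivity

lemma alph_inv : alph⁻¹ = 2 - Real.sqrt 2 := by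
  apply inv_eq_of_mul_eq_one_right
  rw [alph_eq]
  nlinarith [sqrt_two_sq_aux]

lemma M1_eq : M1 = Matrix.vecMulVec ![0, alph⁻¹, 0, 1, 1] ![0, 1, 0, 0, alph] := by
  have h := alph_pos.ne'
  ext i j
  fin_cases i <;> fin_cases j <;> simp [M1, Matrix.vecMulVec, h]

lemma M2_eq : M2 = Matrix.vecMulVec ![alph⁻¹, 0, 1, 0, 1] ![0, 0, 1, alph, 0] := by
  have h := alph_pos.ne'
  ext i j
  fin_cases i <;> fin_cases j <;> simp [M2, Matrix.vecMulVec, h]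

lemma M3_eq : M3 = Matrix.vecMulVec ![Real.sqrt 2, 1, 0, 0, 0] ![1, Real.sqrt 2, 1, 0, 0] := by
  ext i j
  fin_cases i <;> fin_cases j <;> simp [M3, Matrix.vecMulVec]

lemma rank_one_aux (A : Matrix (Fin 5) (Fin 5) ℝ) (u v : Fin 5 → ℝ)
    (h : A = Matrix.vecMulVec u v) (i j : Fin 5) (hij : A i j ≠ 0) : A.rank = 1 := by
  apply le_antisymm
  · rw [h]; exact Matrix.rank_vecMulVec_le u v
  · rw [Nat.one_le_iff_ne_zero]
    intro h0
    rw [Matrix.rank, Submodule.finrank_eq_zero, LinearMap.range_eq_bot] at h0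
    apply hij
    have h1 := congrFun (LinearMap.congr_fun h0 (Pi.single j 1)) i
    simpa using h1

lemma Cmat_eq : Cmat (Real.sqrt 2) alph alph alph = M1 + M2 + M3 := by
  ext i j
  fin_cases i <;> fin_cases j <;> simp [Cmat, M1, M2, M3, alph_inv]

theorem stmt9 :
    Cmat (Real.sqrt 2) alph alph alph = M1 + M2 + M3 ∧
    (∀ i j, 0 ≤ M1 i j) ∧ (∀ i j, 0 ≤ M2 i j) ∧ (∀ i j, 0 ≤ M3 i j) ∧
    M1.rank = 1 ∧ M2.rank = 1 ∧ M3.rank = 1 ∧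
    nnRank ⊤ (Cmat (Real.sqrt 2) alph alph alph) ≤ 3 := by
  have ha := alph_pos
  have hi : 0 < alph⁻¹ := inv_pos.mpr ha
  refine ⟨Cmat_eq, ?_, ?_, ?_, ?_, ?_, ?_, ?_⟩
  · intro i j
    fin_cases i <;> fin_cases j <;> simp [M1, ha.le]
  · intro i j
    fin_cases i <;> fin_cases j <;> simp [M2, ha.le]
  · intro i j
    fin_cases i <;> fin_cases j <;> simp [M3]
  · exact rank_one_aux _ _ _ M1_eq 3 1 (by simp [M1])
  · exact rank_one_aux _ _ _ M2_eq 2 2 (by simp [M2])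
  · exact rank_one_aux _ _ _ M3_eq 1 0 (by simp [M3])
  · apply Nat.sInf_le
    refine ⟨![![0, alph⁻¹, 0, 1, 1], ![alph⁻¹, 0, 1, 0, 1], ![Real.sqrt 2, 1, 0, 0, 0]],
      ![![0, 1, 0, 0, alph], ![0, 0, 1, alph, 0], ![1, Real.sqrt 2, 1, 0, 0]], ?_, ?_, ?_⟩
    · intro l i
      refine ⟨?_, Subfield.mem_top _⟩
      fin_cases l <;> fin_cases i <;> simp [ha.le]
    · intro l i
      refine ⟨?_, Subfield.mem_top _⟩
      fin_cases l <;> fin_cases i <;> simp [ha.le]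
    · rw [Cmat_eq, M1_eq, M2_eq, M3_eq, Fin.sum_univ_three]
      rfl
end

section
/- For all rational numbers a,b,c,d ≥ 0, the 5×5 matrix C(a,b,c,d) = [[a,2,2,1,0],[1,2,1,0,1],[0,0,1,b,0],[0,1,0,0,c],[0,1,1,d,d]] cannot be written as a sum of 3 rank-one matrices with nonnegative rational entries; that is, rank_{ℚ+} C(a,b,c,d) ≥ 4. -/
/-- `A` is a sum of `k` rank-one matrices with nonnegative rational entries. -/
def NNDecompQ {m n : Type*} (A : Matrix m n ℚ) (k : ℕ) : Prop :=
  ∃ u : Fin k → m → ℚ, ∃ v : Fin k → n → ℚ,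
    (∀ l i, 0 ≤ u l i) ∧ (∀ l j, 0 ≤ v l j) ∧
    A = ∑ l, Matrix.vecMulVec (u l) (v l)

/-- The nonnegative rank of a rational matrix `A` with respect to `ℚ`. -/
noncomputable def nnRankQ {m n : Type*} (A : Matrix m n ℚ) : ℕ :=
  sInf {k | NNDecompQ A k}

/-- The 5 × 5 matrix 𝒞(a,b,c,d) of the paper, over ℚ. -/
def CmatQ (a b c d : ℚ) : Matrix (Fin 5) (Fin 5) ℚ :=
  !![a,2,2,1,0;
     1,2,1,0,1;
     0,0,1,b,0;
     0,1,0,0,c;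
     0,1,1,d,d]

lemma two_not_sq (x : ℚ) : x * x ≠ 2 := by
  intro h
  have h2 : Irrational (√2) := irrational_sqrt_two
  apply h2
  refine ⟨|x|, ?_⟩
  have : (2 : ℝ) = (|x| : ℝ) ^ 2 := by
    rw [sq_abs, pow_two]
    exact_mod_cast h.symm
  rw [this, Real.sqrt_sq (abs_nonneg _)]
  push_cast
  rfl

lemma exists_pos_term (A : Matrix (Fin 5) (Fin 5) ℚ) (u v : Fin 3 → Fin 5 → ℚ)
    (hA : A = ∑ l, Matrix.vecMulVec (u l) (v l)) (i j : Fin 5) (h : A i j = 1) :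
    ∃ l, u l i ≠ 0 ∧ v l j ≠ 0 := by
  by_contra! hc
  rw [hA, Matrix.sum_apply] at h
  rw [Finset.sum_eq_zero] at h
  · norm_num at h
  · intro l _
    rw [Matrix.vecMulVec_apply]
    by_cases hu : u l i = 0
    · rw [hu, zero_mul]
    · rw [hc l hu, mul_zero]

lemma zero_term (A : Matrix (Fin 5) (Fin 5) ℚ) (u v : Fin 3 → Fin 5 → ℚ)
    (hu : ∀ l i, 0 ≤ u l i) (hv : ∀ l j, 0 ≤ v l j)
    (hA : A = ∑ l, Matrix.vecMulVec (u l) (v l)) (i j : Fin 5) (h : A i j = 0) (l : Fin 3) :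
    u l i = 0 ∨ v l j = 0 := by
  rw [hA, Matrix.sum_apply,
    Finset.sum_eq_zero_iff_of_nonneg
      (fun l _ => by rw [Matrix.vecMulVec_apply]; exact mul_nonneg (hu l i) (hv l j))] at h
  have := h l (Finset.mem_univ _)
  rw [Matrix.vecMulVec_apply] at this
  exact mul_eq_zero.mp this

lemma no_three (a b c d : ℚ) : ¬ NNDecompQ (CmatQ a b c d) 3 := by
  rintro ⟨u, v, hu, hv, hA⟩
  have Z := zero_term _ u v hu hv hA
  obtain ⟨x, hx1, hx2⟩ := exists_pos_term _ u v hA 1 0 (by simp [CmatQ])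
  obtain ⟨y, hy1, hy2⟩ := exists_pos_term _ u v hA 2 2 (by simp [CmatQ])
  obtain ⟨z, hz1, hz2⟩ := exists_pos_term _ u v hA 3 1 (by simp [CmatQ])
  have z04 := Z 0 4 (by simp [CmatQ])
  have z13 := Z 1 3 (by simp [CmatQ])
  have z20 := Z 2 0 (by simp [CmatQ])
  have z21 := Z 2 1 (by simp [CmatQ])
  have z24 := Z 2 4 (by simp [CmatQ])
  have z30 := Z 3 0 (by simp [CmatQ])
  have z32 := Z 3 2 (by simp [CmatQ])
  have z33 := Z 3 3 (by simp [CmatQ])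
  have z40 := Z 4 0 (by simp [CmatQ])
  have hxy : x ≠ y := by rintro rfl; exact (z20 x).elim hy1 hx2
  have hxz : x ≠ z := by rintro rfl; exact (z30 x).elim hz1 hx2
  have hyz : y ≠ z := by rintro rfl; exact (z21 y).elim hy1 hz2
  have hun : (Finset.univ : Finset (Fin 3)) = {x, y, z} := by
    clear * - hxy hxz hyz
    revert x y z
    decide
  have E : ∀ i j, CmatQ a b c d i j = u x i * v x j + (u y i * v y j + u z i * v z j) := by
    intro i j
    rw [hA, Matrix.sum_apply, hun, Finset.sum_insert (by simp [hxy, hxz]),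
      Finset.sum_pair hyz]
    simp only [Matrix.vecMulVec_apply]
  have x4 : u x 4 = 0 := (z40 x).resolve_right hx2
  have xv3 : v x 3 = 0 := (z13 x).resolve_left hx1
  have yv1 : v y 1 = 0 := (z21 y).resolve_left hy1
  have yv4 : v y 4 = 0 := (z24 y).resolve_left hy1
  have zv2 : v z 2 = 0 := (z32 z).resolve_left hz1
  have zv3 : v z 3 = 0 := (z33 z).resolve_left hz1
  have e01 := E 0 1
  have e02 := E 0 2
  have e03 := E 0 3
  have e11 := E 1 1
  have e12 := E 1 2
  have e14 := E 1 4
  have e41 := E 4 1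
  have e42 := E 4 2
  have e43 := E 4 3
  have e44 := E 4 4
  simp [CmatQ, x4, xv3, yv1, yv4, zv2, zv3] at e01 e02 e03 e11 e12 e14 e41 e42 e43 e44
  have ys3 : v y 3 ≠ 0 := by intro h; simp [h] at e03
  have y1 : u y 1 = 0 := (z13 y).resolve_right ys3
  have hd : d ≠ 0 := by
    rintro rfl
    rcases mul_eq_zero.mp e43.symm with h | h
    · simp [h] at e42
    · exact ys3 h
  have zv4 : v z 4 ≠ 0 := by
    intro h; simp [h] at e44; exact hd e44
  have z0 : u z 0 = 0 := (z04 z).resolve_right zv4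
  simp [z0] at e01
  have x0 : u x 0 ≠ 0 := by intro h; simp [h] at e01
  have xv4 : v x 4 = 0 := (z04 x).resolve_left x0
  simp [y1] at e12
  simp [xv4] at e14
  have s3 : v y 3 = d * v y 2 := by linear_combination (v y 3) * e42 - (v y 2) * e43
  have w4 : v z 4 = d * v z 1 := by linear_combination (v z 4) * e41 - (v z 1) * e44
  have f1 : d * (u y 0 * v y 2) = 1 := by rw [e03, s3]; ring
  have f2 : d * (u z 1 * v z 1) = 1 := by rw [e14, w4]; ring
  have f3 : u y 0 * v y 2 = u z 1 * v z 1 := mul_left_cancel₀ hd (f1.trans f2.symm)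
  apply two_not_sq (u x 0 * v x 2)
  have f4 : u x 0 * v x 2 = u x 1 * v x 1 := by linarith
  calc (u x 0 * v x 2) * (u x 0 * v x 2) = (u x 0 * v x 2) * (u x 1 * v x 1) := by rw [← f4]
    _ = (u x 0 * v x 1) * (u x 1 * v x 2) := by ring
    _ = 2 := by rw [← e01, ← e12, mul_one]

lemma decomp_succ {m n : Type*} (A : Matrix m n ℚ) (k : ℕ) (h : NNDecompQ A k) :
    NNDecompQ A (k + 1) := by
  obtain ⟨u, v, hu, hv, hA⟩ := h
  refine ⟨Fin.cons 0 u, Fin.cons 0 v, ?_, ?_, ?_⟩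
  · intro l
    refine Fin.cases ?_ ?_ l <;> simp [hu]
  · intro l
    refine Fin.cases ?_ ?_ l <;> simp [hv]
  · rw [Fin.sum_univ_succ]
    simpa using hA

lemma decomp_mono {m n : Type*} (A : Matrix m n ℚ) {k k' : ℕ} (hk : k ≤ k')
    (h : NNDecompQ A k) : NNDecompQ A k' :=
  Nat.le_induction h (fun n _ ih => decomp_succ A n ih) k' hk

lemma decomp_five (A : Matrix (Fin 5) (Fin 5) ℚ) (hA : ∀ i j, 0 ≤ A i j) : NNDecompQ A 5 := by
  refine ⟨fun l i => if i = l then 1 else 0, fun l => A l, ?_, fun l j => hA l j, ?_⟩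
  · intro l i
    dsimp only
    split_ifs <;> norm_num
  · ext i j
    simp [Matrix.sum_apply, Matrix.vecMulVec_apply]

theorem stmt10 (a b c d : ℚ) (ha : 0 ≤ a) (hb : 0 ≤ b) (hc : 0 ≤ c) (hd : 0 ≤ d) :
    ¬ NNDecompQ (CmatQ a b c d) 3 ∧ 4 ≤ nnRankQ (CmatQ a b c d) := by
  refine ⟨no_three a b c d, ?_⟩
  have hne : {k | NNDecompQ (CmatQ a b c d) k}.Nonempty := by
    refine ⟨5, decomp_five _ ?_⟩
    intro i j
    fin_cases i <;> fin_cases j <;> simp [CmatQ, ha, hb, hc, hd]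
  refine le_csInf hne ?_
  intro k hk
  by_contra! hlt
  exact no_three a b c d (decomp_mono _ (by omega) hk)
end

section
/- Let α = 1 + √(1/2) and a = 2 − 1/α = √2. Then the 5×5 real matrix C(√2,α,α,α,α) = [[√2,2,2,1,0],[1,2,1,0,1],[0,0,1,α,0],[0,1,0,0,α],[0,1,1,α,α]] has nonnegative entries, all its entries lie in the interval-constraint set required by the reduction (namely √2, α ∈ [1,2]), and its nonnegative rank over ℝ equals 3. -/
theorem stmt15 :
    2 - 1/alph = Real.sqrt 2 ∧
    (∀ i j, 0 ≤ Cmat (Real.sqrt 2) alph alph alph i j) ∧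
    Real.sqrt 2 ∈ Set.Icc (1 : ℝ) 2 ∧ alph ∈ Set.Icc (1 : ℝ) 2 ∧
    nnRank ⊤ (Cmat (Real.sqrt 2) alph alph alph) = 3 := by
  obtain ⟨s, hs⟩ : ∃ s, s = Real.sqrt 2 := ⟨_, rfl⟩
  have hs0 : 0 ≤ s := hs ▸ Real.sqrt_nonneg 2
  have hss : s * s = 2 := by rw [hs]; exact Real.mul_self_sqrt (by norm_num)
  have hs1 : 1 ≤ s := by nlinarith
  have hs2 : s ≤ 2 := by nlinarith
  have ha : alph = 1 + s / 2 := by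
    have : Real.sqrt (1/2) = s / 2 := by
      rw [Real.sqrt_eq_iff_mul_self_eq (by norm_num) (by positivity)]
      linarith
    rw [alph, this]
  rw [← hs, ha]
  refine ⟨?_, ?_, ⟨hs1, hs2⟩, ⟨by linarith, by linarith⟩, ?_⟩
  · have : (1 + s / 2) ≠ 0 := by positivity
    field_simp
    nlinarith
  · have : 0 ≤ 1 + s / 2 := by positivity
    intro i j
    fin_cases i <;> fin_cases j <;> simp [Cmat] <;> assumption
  · have h2s : 0 ≤ 2 - s := by linarith
    have hb : 0 ≤ 1 + s / 2 := by positivity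
    have hmem : NNDecomp ⊤ (Cmat s (1 + s / 2) (1 + s / 2) (1 + s / 2)) 3 := by
      refine ⟨![![s, 1, 0, 0, 0], ![1, 0, 1 + s / 2, 0, 1 + s / 2],
        ![0, 1, 0, 1 + s / 2, 1 + s / 2]],
        ![![1, s, 1, 0, 0], ![0, 0, 2 - s, 1, 0], ![0, 2 - s, 0, 0, 1]], ?_, ?_, ?_⟩
      · intro l i
        refine ⟨?_, Subfield.mem_top _⟩
        fin_cases l <;> fin_cases i <;> simp <;> assumption
      · intro l i
        refine ⟨?_, Subfield.mem_top _⟩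
        fin_cases l <;> fin_cases i <;> simp <;> linarith
      · ext i j
        fin_cases i <;> fin_cases j <;>
          simp [Cmat, Fin.sum_univ_three, Matrix.vecMulVec_apply] <;> nlinarith
    refine le_antisymm (Nat.sInf_le hmem) ?_
    refine le_csInf ⟨3, hmem⟩ ?_
    rintro k ⟨u, v, -, -, hA⟩
    have hE : ∀ i j, Cmat s (1 + s / 2) (1 + s / 2) (1 + s / 2) i j = ∑ l, u l i * v l j := by
      intro i j
      rw [hA]
      simp [Matrix.sum_apply, Matrix.vecMulVec_apply]
    have h00 := hE 1 0
    have h01 := hE 1 3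
    have h02 := hE 1 4
    have h10 := hE 2 0
    have h11 := hE 2 3
    have h12 := hE 2 4
    have h20 := hE 3 0
    have h21 := hE 3 3
    have h22 := hE 3 4
    by_contra hk
    have hpos : 0 < (1 + s / 2) * (1 + s / 2) := by positivity
    simp [Cmat] at h00 h01 h02 h10 h11 h12 h20 h21 h22
    have key : ∀ a b c d e f p q r x y z : ℝ,
        (a * p + d * x) * ((b * q + e * y) * (c * r + f * z)
          - (b * r + e * z) * (c * q + f * y))
        - (a * q + d * y) * ((b * p + e * x) * (c * r + f * z)
          - (b * r + e * z) * (c * p + f * x))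
        + (a * r + d * z) * ((b * p + e * x) * (c * q + f * y)
          - (b * q + e * y) * (c * p + f * x)) = 0 := by intros; ring
    obtain rfl | rfl | rfl : k = 0 ∨ k = 1 ∨ k = 2 := by omega
    · simp at h00
    · simp only [Fin.sum_univ_one] at h00 h01 h02 h10 h11 h12 h20 h21 h22
      have := key (u 0 1) (u 0 2) (u 0 3) 0 0 0 (v 0 0) (v 0 3) (v 0 4) 0 0 0
      simp only [mul_zero, add_zero] at this
      rw [← h00, ← h10, ← h11, ← h12, ← h20, ← h21, ← h22] at this
      nlinarith
    · simp only [Fin.sum_univ_two] at h00 h01 h02 h10 h11 h12 h20 h21 h22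
      have := key (u 0 1) (u 0 2) (u 0 3) (u 1 1) (u 1 2) (u 1 3)
        (v 0 0) (v 0 3) (v 0 4) (v 1 0) (v 1 3) (v 1 4)
      rw [← h00, ← h10, ← h11, ← h12, ← h20, ← h21, ← h22] at this
      nlinarith
end
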